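/- arXiv:1309.1413 — 6 statements merged into one kernel-verified Lean document; each statement's English description precedes it below -/
import Mathlib

section
/- Let d ≥ 1 and let {I_{i_1,…,i_{d+1}} : (i_1,…,i_{d+1}) ∈ ℤ^{d+1}} be a family of pairwise disjoint nondegenerate closed subintervals of [0,1] disposed respecting the lexicographic order. Let f_1,…,f_{d+1} be C^1 diffeomorphisms of [0,1] onto itself such that for every 1 ≤ j ≤ d+1 and every (i_1,…,i_{d+1}) ∈ ℤ^{d+1} one has f_j(I_{i_1,…,i_{j-1},i_j,i_{j+1},…,i_{d+1}}) = I_{i_1,…,i_{j-1},1+i_j,i_{j+1},…,i_{d+1}}. If f_{d+1} is of class C^{1+α} for some α > 0 and commutes with each of f_1,…,f_d, then f_1,…,f_d cannot all be of class C^{1+1/d}. -/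
namespace GK
open Finset

lemma reindex (d n : ℕ) (j : Fin d) (c : (Fin d → ℕ) → ℝ) :
    ∑ u ∈ piAntidiag (univ : Finset (Fin d)) n, ((u j : ℝ) + 1) * c (u + Pi.single j 1)
      = ∑ v ∈ piAntidiag (univ : Finset (Fin d)) (n + 1), (v j : ℝ) * c v := by
  rw [← Finset.sum_filter_of_ne (s := piAntidiag (univ : Finset (Fin d)) (n + 1))
    (p := fun v => v j ≠ 0)]
  · refine Finset.sum_bij' (fun u _ => u + Pi.single j 1) (fun v _ => v - Pi.single j 1) ?_ ?_ ?_ ?_ ?_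
    · intro u hu
      simp only [mem_piAntidiag, mem_filter] at hu ⊢
      simp [sum_add_distrib, hu.1, Pi.single_apply]
    · intro v hv
      simp only [mem_piAntidiag, mem_filter] at hv ⊢
      refine ⟨?_, by simp⟩
      have h : v = (v - Pi.single j 1) + Pi.single j 1 := by
        funext i
        by_cases hi : i = j
        · subst hi; simp; omega
        · simp [hi]
      have h2 := hv.1.1
      rw [h] at h2
      simp only [Pi.add_apply, sum_add_distrib] at h2
      simpa [Pi.single_apply] using h2
    · intro u hu
      simp
    · intro v hv
      simp only [mem_filter] at hv
      funext i
      by_cases hi : i = j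
      · subst hi; simp; omega
      · simp [hi]
    · intro u hu
      simp
  · intro v _ h h0
    simp [h0] at h

lemma path_exists (e : ℕ) (M : ℕ) : ∀ (c : (Fin (e+1) → ℕ) → ℝ),
    ∃ p : ℕ → (Fin (e+1) → ℕ), p 0 = 0 ∧
      (∀ n < M, ∃ j, p (n+1) = p n + Pi.single j 1) ∧ (∀ n ≤ M, ∑ i, p n i = n) ∧
      ∑ n ∈ range (M+1), c (p n) ≤
        ∑ n ∈ range (M+1), (∑ v ∈ piAntidiag (univ : Finset (Fin (e+1))) n, c v)
          / ((n+e).choose e : ℝ) := by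
  induction M with
  | zero =>
    intro c
    refine ⟨fun _ => 0, rfl, by simp, by simp, ?_⟩
    simp
  | succ M ih =>
    intro c
    choose m hm using fun u : Fin (e+1) → ℕ =>
      Finite.exists_min (fun j => c (u + Pi.single j 1))
    obtain ⟨p, p0, pstep, psum, hp⟩ := ih (fun u => if ∑ i, u i = M then
      c u + c (u + Pi.single (m u) 1) else c u)
    refine ⟨fun n => if n = M + 1 then p M + Pi.single (m (p M)) 1 else p n, by simp [p0],
      ?_, ?_, ?_⟩
    · intro n hn
      rcases Nat.lt_succ_iff_lt_or_eq.1 hn with h | h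
      · obtain ⟨j, hj⟩ := pstep n h
        refine ⟨j, ?_⟩
        beta_reduce
        rw [if_neg (by omega), if_neg (by omega), hj]
      · subst h
        exact ⟨m (p n), by simp⟩
    · intro n hn
      rcases Nat.le_succ_iff.1 hn with h | h
      · simp only [show n ≠ M + 1 by omega, if_false]
        exact psum n h
      · subst h
        simp [sum_add_distrib, psum M le_rfl, Pi.single_apply]
    · rw [sum_range_succ, sum_range_succ _ (M+1)]
      have e1 : ∑ n ∈ range (M+1), (c (if n = M + 1 then p M + Pi.single (m (p M)) 1 else p n))
          + c (p M + Pi.single (m (p M)) 1) = ∑ n ∈ range (M+1), (if ∑ i, p n i = M then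
            c (p n) + c (p n + Pi.single (m (p n)) 1) else c (p n)) := by
        rw [sum_range_succ, sum_range_succ _ M, if_pos (psum M le_rfl)]
        have : ∀ n ∈ range M, (c (if n = M + 1 then p M + Pi.single (m (p M)) 1 else p n)) =
          (if ∑ i, p n i = M then
            c (p n) + c (p n + Pi.single (m (p n)) 1) else c (p n)) := by
          intro n hn
          rw [mem_range] at hn
          rw [if_neg (by omega), if_neg]
          rw [psum n (by omega)]; omega
        rw [sum_congr rfl this]
        simp
        ring
      simp only [if_true]
      rw [e1]
      refine hp.trans ?_
      rw [sum_range_succ, sum_range_succ _ M, add_assoc]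
      refine add_le_add (le_of_eq ?_) ?_
      · refine sum_congr rfl fun n hn => ?_
        rw [mem_range] at hn
        congr 1
        refine sum_congr rfl fun v hv => ?_
        rw [mem_piAntidiag] at hv
        rw [if_neg]; rw [hv.1]; omega
      · have e2 : ∑ v ∈ piAntidiag (univ : Finset (Fin (e+1))) M, (if ∑ i, v i = M then
            c v + c (v + Pi.single (m v) 1) else c v) =
            ∑ v ∈ piAntidiag (univ : Finset (Fin (e+1))) M, c v +
            ∑ v ∈ piAntidiag (univ : Finset (Fin (e+1))) M, c (v + Pi.single (m v) 1) := by
          rw [← sum_add_distrib]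
          refine sum_congr rfl fun v hv => ?_
          rw [mem_piAntidiag] at hv
          rw [if_pos hv.1]
        rw [e2, add_div]
        refine add_le_add le_rfl ?_
        have hN : (0:ℝ) < ((M+e).choose e : ℝ) := by
          exact_mod_cast Nat.choose_pos (by omega)
        have hN' : (0:ℝ) < ((M+1+e).choose e : ℝ) := by
          exact_mod_cast Nat.choose_pos (by omega)
        have hrec : ((M+e).choose e : ℝ) * (M+e+1) = ((M+1+e).choose e : ℝ) * (M+1) := by
          have := Nat.choose_mul_succ_eq (M+e) e
          rw [show M + e + 1 - e = M + 1 by omega, show M + e + 1 = M + 1 + e by omega] at this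
          have h2 := congrArg (Nat.cast (R := ℝ)) this
          push_cast at h2
          linarith
        have key : (∑ v ∈ piAntidiag (univ : Finset (Fin (e+1))) M, c (v + Pi.single (m v) 1))
            * (M+e+1) ≤ (M+1) * ∑ v ∈ piAntidiag (univ : Finset (Fin (e+1))) (M+1), c v := by
          calc _ = ∑ v ∈ piAntidiag (univ : Finset (Fin (e+1))) M,
                ∑ j, ((v j : ℝ) + 1) * c (v + Pi.single (m v) 1) := by
                rw [sum_mul]
                refine sum_congr rfl fun v hv => ?_
                rw [mem_piAntidiag] at hv
                rw [← sum_mul, sum_add_distrib, ← Nat.cast_sum, hv.1]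
                simp; ring
            _ ≤ ∑ v ∈ piAntidiag (univ : Finset (Fin (e+1))) M,
                ∑ j, ((v j : ℝ) + 1) * c (v + Pi.single j 1) := by
                refine sum_le_sum fun v _ => sum_le_sum fun j _ => ?_
                exact mul_le_mul_of_nonneg_left (hm v j) (by positivity)
            _ = ∑ j, ∑ v ∈ piAntidiag (univ : Finset (Fin (e+1))) (M+1), (v j : ℝ) * c v := by
                rw [sum_comm]
                exact sum_congr rfl fun j _ => reindex _ _ _ _
            _ = _ := by
                rw [sum_comm, mul_sum]
                refine sum_congr rfl fun v hv => ?_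
                rw [mem_piAntidiag] at hv
                rw [← sum_mul, ← Nat.cast_sum, hv.1]
                simp
        rw [div_le_div_iff₀ hN hN']
        have hpos : (0:ℝ) < M + e + 1 := by positivity
        have h3 := mul_le_mul_of_nonneg_right key hN.le
        refine le_of_mul_le_mul_right ?_ (show (0:ℝ) < M + 1 by positivity)
        calc _ = (∑ v ∈ piAntidiag (univ : Finset (Fin (e+1))) M, c (v + Pi.single (m v) 1))
             * (((M+1+e).choose e : ℝ) * (M+1)) := by ring
          _ = _ := by rw [← hrec]
          _ ≤ _ := by linarith

lemma pow_le_choose (e n : ℕ) : ((n:ℝ)+1)^e ≤ (e.factorial : ℝ) * ((n+e).choose e : ℝ) := by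
  have h1 := Nat.pow_succ_le_ascFactorial (n+1) e
  have h2 := Nat.ascFactorial_eq_factorial_mul_choose n e
  have h3 : (n+1)^e ≤ e.factorial * (n+e).choose e := by
    rw [← h2]; simpa using h1
  exact_mod_cast h3

lemma young (e n : ℕ) (D ε : ℝ) (hD : 0 ≤ D) (hε : 0 < ε) :
    D ^ ((1:ℝ) / ((e+1 : ℕ):ℝ)) ≤ (ε⁻¹)^e * (((n:ℝ)+1)^e * D) + ε * ((n:ℝ)+1)⁻¹ := by
  set t := D ^ ((1:ℝ) / ((e+1 : ℕ):ℝ)) with ht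
  have ht0 : 0 ≤ t := Real.rpow_nonneg hD _
  have htD : D = t^(e+1) := by
    rw [ht, one_div, Real.rpow_inv_natCast_pow hD (by omega)]
  rw [htD]
  set s := ε * ((n:ℝ)+1)⁻¹ with hs
  have hs0 : 0 < s := by positivity
  have : (ε⁻¹)^e * (((n:ℝ)+1)^e * t^(e+1)) = t * (t/s)^e := by
    rw [hs, pow_succ, ← mul_assoc, ← mul_assoc, ← mul_pow, ← mul_pow, mul_comm _ t]
    congr 2
    field_simp
  rw [this]
  rcases le_total t s with h | h
  · have : 0 ≤ t * (t/s)^e := by positivity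
    linarith
  · have : 1 ≤ (t/s)^e := one_le_pow₀ ((one_le_div hs0).2 h)
    nlinarith

open MeasureTheory in
lemma sum_le_one {ι : Type*} (s : Finset ι) (A B : ι → ℝ) (hA : ∀ i ∈ s, 0 ≤ A i)
    (hB : ∀ i ∈ s, B i ≤ 1) (hAB : ∀ i ∈ s, A i ≤ B i)
    (hd : ∀ i ∈ s, ∀ j ∈ s, i ≠ j → B i ≤ A j ∨ B j ≤ A i) :
    ∑ i ∈ s, (B i - A i) ≤ 1 := by
  have h1 : volume (⋃ i ∈ s, Set.Ioo (A i) (B i)) = ∑ i ∈ s, volume (Set.Ioo (A i) (B i)) := by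
    refine measure_biUnion_finset ?_ (fun _ _ => measurableSet_Ioo)
    intro i hi j hj hij
    refine Set.disjoint_left.2 fun x hx hy => ?_
    rcases hd i hi j hj hij with h | h
    · exact absurd (hx.2.trans_le h) (not_lt.2 hy.1.le)
    · exact absurd (hy.2.trans_le h) (not_lt.2 hx.1.le)
  have h2 : volume (⋃ i ∈ s, Set.Ioo (A i) (B i)) ≤ volume (Set.Icc (0:ℝ) 1) := by
    refine measure_mono (Set.iUnion₂_subset fun i hi x hx => ?_)
    exact ⟨(hA i hi).trans hx.1.le, hx.2.le.trans (hB i hi)⟩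
  rw [h1] at h2
  simp only [Real.volume_Ioo, Real.volume_Icc] at h2
  rw [← ENNReal.ofReal_sum_of_nonneg (fun i hi => sub_nonneg.2 (hAB i hi))] at h2
  rw [ENNReal.ofReal_le_ofReal_iff (by norm_num)] at h2
  linarith

lemma mvt (f : ℝ → ℝ) (hf : ContDiffOn ℝ 1 f (Set.Icc 0 1)) (x y : ℝ) (hx : 0 ≤ x) (hxy : x < y)
    (hy : y ≤ 1) : ∃ ξ ∈ Set.Icc x y, f y - f x = derivWithin f (Set.Icc 0 1) ξ * (y - x) := by
  have hd := hf.differentiableOn (by norm_num)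
  obtain ⟨ξ, hξ, h⟩ := exists_hasDerivAt_eq_slope f (derivWithin f (Set.Icc 0 1)) hxy
    (hf.continuousOn.mono (Set.Icc_subset_Icc hx hy)) (fun z hz =>
      (hd z ⟨by linarith [hz.1], by linarith [hz.2]⟩).hasDerivWithinAt.hasDerivAt
        (Icc_mem_nhds (by linarith [hz.1]) (by linarith [hz.2])))
  refine ⟨ξ, ⟨hξ.1.le, hξ.2.le⟩, ?_⟩
  rw [h]; field_simp [sub_ne_zero.2 hxy.ne']

lemma mvt_image (f : ℝ → ℝ) (hf : ContDiffOn ℝ 1 f (Set.Icc 0 1)) (x y x' y' : ℝ) (hx : 0 ≤ x)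
    (hxy : x < y) (hy : y ≤ 1) (hxy' : x' < y') (him : f '' Set.Icc x y = Set.Icc x' y') :
    (∃ ξ ∈ Set.Icc x y, |derivWithin f (Set.Icc 0 1) ξ| * (y - x) ≤ y' - x') ∧
    (∃ ξ ∈ Set.Icc x y, y' - x' ≤ |derivWithin f (Set.Icc 0 1) ξ| * (y - x)) := by
  constructor
  · obtain ⟨ξ, hξ, h⟩ := mvt f hf x y hx hxy hy
    refine ⟨ξ, hξ, ?_⟩
    rw [← abs_of_pos (sub_pos.2 hxy), ← abs_mul, ← h]
    have h1 : f x ∈ Set.Icc x' y' := him ▸ Set.mem_image_of_mem f ⟨le_rfl, hxy.le⟩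
    have h2 : f y ∈ Set.Icc x' y' := him ▸ Set.mem_image_of_mem f ⟨hxy.le, le_rfl⟩
    rw [abs_le]
    constructor <;> linarith [h1.1, h1.2, h2.1, h2.2]
  · obtain ⟨p, hp, hp'⟩ : x' ∈ f '' Set.Icc x y := him ▸ ⟨le_rfl, hxy'.le⟩
    obtain ⟨q, hq, hq'⟩ : y' ∈ f '' Set.Icc x y := him ▸ ⟨hxy'.le, le_rfl⟩
    have key : ∀ p ∈ Set.Icc x y, ∀ q ∈ Set.Icc x y, p < q → ∃ ξ ∈ Set.Icc x y,
        |f q - f p| ≤ |derivWithin f (Set.Icc 0 1) ξ| * (y - x) := by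
      intro p hp q hq hpq
      obtain ⟨ξ, hξ, h⟩ := mvt f hf p q (hx.trans hp.1) hpq (hq.2.trans hy)
      refine ⟨ξ, ⟨hp.1.trans hξ.1, hξ.2.trans hq.2⟩, ?_⟩
      rw [h, abs_mul, abs_of_pos (sub_pos.2 hpq)]
      exact mul_le_mul_of_nonneg_left (by linarith [hp.1, hq.2]) (abs_nonneg _)
    rcases lt_trichotomy p q with h | h | h
    · obtain ⟨ξ, hξ, h⟩ := key p hp q hq h
      exact ⟨ξ, hξ, by rw [← hp', ← hq']; exact (le_abs_self _).trans h⟩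
    · subst h; linarith
    · obtain ⟨ξ, hξ, h⟩ := key q hq p hp h
      exact ⟨ξ, hξ, by rw [← hp', ← hq', ← abs_sub_comm] at *; exact (le_abs_self _).trans h⟩

lemma card_level (e n : ℕ) : ((piAntidiag (univ : Finset (Fin (e+1))) n).card : ℝ)
    = ((n+e).choose e : ℝ) := by
  induction n with
  | zero => simp
  | succ n ih =>
    have hrec : ((n+e).choose e : ℝ) * (n+e+1) = ((n+1+e).choose e : ℝ) * (n+1) := by
      have := Nat.choose_mul_succ_eq (n+e) e
      rw [show n + e + 1 - e = n + 1 by omega, show n + e + 1 = n + 1 + e by omega] at this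
      have h2 := congrArg (Nat.cast (R := ℝ)) this
      push_cast at h2
      linarith
    have h1 := Finset.sum_congr (s₁ := (univ : Finset (Fin (e+1)))) rfl
      (fun j _ => reindex (e+1) n j (fun _ => 1))
    rw [sum_comm, sum_comm (s := univ)] at h1
    have hL : ∑ u ∈ piAntidiag (univ : Finset (Fin (e+1))) n, ∑ j, ((u j : ℝ) + 1) * 1
        = ((piAntidiag (univ : Finset (Fin (e+1))) n).card : ℝ) * (n+e+1) := by
      rw [← nsmul_eq_mul, ← sum_const]
      refine sum_congr rfl fun v hv => ?_
      rw [mem_piAntidiag] at hv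
      rw [← sum_mul, sum_add_distrib, ← Nat.cast_sum, hv.1]
      simp; ring
    have hR : ∑ u ∈ piAntidiag (univ : Finset (Fin (e+1))) (n+1), ∑ j, (u j : ℝ) * 1
        = ((piAntidiag (univ : Finset (Fin (e+1))) (n+1)).card : ℝ) * (n+1) := by
      rw [← nsmul_eq_mul, ← sum_const]
      refine sum_congr rfl fun v hv => ?_
      rw [mem_piAntidiag] at hv
      rw [← sum_mul, ← Nat.cast_sum, hv.1]
      simp
    rw [hL, hR, ih, hrec] at h1
    exact (mul_right_cancel₀ (by positivity) h1).symm

lemma avg_bound (e M : ℕ) (D : (Fin (e+1) → ℕ) → ℝ) (hD : ∀ v, 0 < D v)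
    (h3 : ∀ s : Finset (Fin (e+1) → ℕ), ∑ v ∈ s, D v ≤ 1) (ε : ℝ) (hε : 0 < ε) :
    ∑ n ∈ range (M+1), (∑ v ∈ piAntidiag (univ : Finset (Fin (e+1))) n,
        D v ^ ((1:ℝ) / ((e+1 : ℕ):ℝ))) / ((n+e).choose e : ℝ)
      ≤ (ε⁻¹)^e * e.factorial + ε * (1 + Real.log (M+1)) := by
  have hN : ∀ n : ℕ, (0:ℝ) < ((n+e).choose e : ℝ) := fun n => by
    exact_mod_cast Nat.choose_pos (by omega)
  have hcard : ∀ n : ℕ, ((piAntidiag (univ : Finset (Fin (e+1))) n).card : ℝ)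
      = ((n+e).choose e : ℝ) := fun n => by
    exact card_level e n
  have hlev : ∀ n : ℕ, (∑ v ∈ piAntidiag (univ : Finset (Fin (e+1))) n,
        D v ^ ((1:ℝ) / ((e+1 : ℕ):ℝ))) / ((n+e).choose e : ℝ) ≤
        (ε⁻¹)^e * e.factorial * (∑ v ∈ piAntidiag (univ : Finset (Fin (e+1))) n, D v)
          + ε * ((n:ℝ)+1)⁻¹ := by
    intro n
    rw [div_le_iff₀ (hN n)]
    calc _ ≤ ∑ v ∈ piAntidiag (univ : Finset (Fin (e+1))) n,
          ((ε⁻¹)^e * (((n:ℝ)+1)^e * D v) + ε * ((n:ℝ)+1)⁻¹) :=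
          sum_le_sum fun v _ => young e n (D v) ε (hD v).le hε
      _ = (ε⁻¹)^e * ((n:ℝ)+1)^e * (∑ v ∈ piAntidiag (univ : Finset (Fin (e+1))) n, D v)
          + ε * ((n:ℝ)+1)⁻¹ * ((n+e).choose e : ℝ) := by
          rw [sum_add_distrib, sum_const, nsmul_eq_mul, hcard, mul_sum, mul_comm ((n+e).choose e : ℝ)]
          congr 1
          exact sum_congr rfl fun _ _ => by ring
      _ ≤ (ε⁻¹)^e * ((e.factorial : ℝ) * ((n+e).choose e : ℝ)) *
            (∑ v ∈ piAntidiag (univ : Finset (Fin (e+1))) n, D v)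
          + ε * ((n:ℝ)+1)⁻¹ * ((n+e).choose e : ℝ) := by
          gcongr
          · exact sum_nonneg fun v _ => (hD v).le
          · exact pow_le_choose e n
      _ = _ := by ring
  refine (sum_le_sum fun n _ => hlev n).trans ?_
  rw [sum_add_distrib, ← mul_sum, ← mul_sum]
  refine add_le_add ?_ ?_
  · have : ∑ n ∈ range (M+1), ∑ v ∈ piAntidiag (univ : Finset (Fin (e+1))) n, D v ≤ 1 := by
      rw [← sum_biUnion]
      · exact h3 _
      · intro m _ n _ hmn
        refine disjoint_left.2 fun v hv hv' => hmn ?_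
        rw [mem_piAntidiag] at hv hv'
        rw [← hv.1, hv'.1]
    exact mul_le_of_le_one_right (by positivity) this
  · refine mul_le_mul_of_nonneg_left ?_ hε.le
    have := harmonic_le_one_add_log (M+1)
    simpa [harmonic] using this

lemma level_freq (e : ℕ) (D : (Fin (e+1) → ℕ) → ℝ) (hD : ∀ v, 0 < D v)
    (h3 : ∀ s : Finset (Fin (e+1) → ℕ), ∑ v ∈ s, D v ≤ 1) (M0 : ℕ) :
    ∃ M ≥ M0, (M:ℝ) * ∑ v ∈ piAntidiag (univ : Finset (Fin (e+1))) M, D v ≤ 1 := by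
  by_contra! hcon
  have hsum : Summable (fun n : ℕ => ∑ v ∈ piAntidiag (univ : Finset (Fin (e+1))) n, D v) := by
    refine summable_of_sum_range_le (c := 1) (fun n => sum_nonneg fun v _ => (hD v).le) fun M => ?_
    rw [← sum_biUnion]
    · exact h3 _
    · intro m _ n _ hmn
      refine disjoint_left.2 fun v hv hv' => hmn ?_
      rw [mem_piAntidiag] at hv hv'
      rw [← hv.1, hv'.1]
  refine Real.not_summable_one_div_natCast ?_
  rw [← summable_nat_add_iff (M0+1)] at hsum ⊢
  refine Summable.of_nonneg_of_le (fun n => by positivity) (fun n => ?_) hsum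
  have h := hcon (n + (M0+1)) (by omega)
  rw [div_le_iff₀ (by positivity)]
  linarith

lemma good_path (e : ℕ) (D : (Fin (e+1) → ℕ) → ℝ) (hD : ∀ v, 0 < D v)
    (h3 : ∀ s : Finset (Fin (e+1) → ℕ), ∑ v ∈ s, D v ≤ 1) (ε : ℝ) (hε : 0 < ε) (M0 : ℕ) :
    ∃ M ≥ M0, ∃ p : ℕ → (Fin (e+1) → ℕ), p 0 = 0 ∧
      (∀ n < M, ∃ j, p (n+1) = p n + Pi.single j 1) ∧
      ∑ n ∈ range (M+1), D (p n) ^ ((1:ℝ) / ((e+1 : ℕ):ℝ))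
        ≤ 2 * ((ε⁻¹)^e * e.factorial + ε * (1 + Real.log (M+1))) ∧ M * D (p M) ≤ 2 := by
  obtain ⟨M, hM, hL⟩ := level_freq e D hD h3 M0
  refine ⟨M, hM, ?_⟩
  have hav := avg_bound e M D hD h3 ε hε
  set T := (ε⁻¹)^e * e.factorial + ε * (1 + Real.log (M+1)) with hT
  have hTpos : 0 < T := by
    have : 0 ≤ Real.log ((M:ℝ)+1) := Real.log_nonneg (by linarith [Nat.cast_nonneg (α := ℝ) M])
    positivity
  obtain ⟨p, p0, pst, psum, hp⟩ := path_exists e M (fun v => D v ^ ((1:ℝ) / ((e+1 : ℕ):ℝ)) / T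
    + if ∑ i, v i = M then M * D v else 0)
  refine ⟨p, p0, pst, ?_⟩
  have hN1 : (1:ℝ) ≤ ((M+e).choose e : ℝ) := by
    exact_mod_cast Nat.choose_pos (by omega)
  have hr : ∑ n ∈ range (M+1), (∑ v ∈ piAntidiag (univ : Finset (Fin (e+1))) n,
        (D v ^ ((1:ℝ) / ((e+1 : ℕ):ℝ)) / T + if ∑ i, v i = M then M * D v else 0))
          / ((n+e).choose e : ℝ) ≤ 2 := by
    simp only [sum_add_distrib, add_div]
    have h1 : ∑ n ∈ range (M+1), (∑ v ∈ piAntidiag (univ : Finset (Fin (e+1))) n,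
        (D v ^ ((1:ℝ) / ((e+1 : ℕ):ℝ)) / T)) / ((n+e).choose e : ℝ) ≤ 1 := by
      simp only [← sum_div, div_right_comm _ T]
      rw [div_le_one hTpos]
      exact hav
    have h2 : ∑ n ∈ range (M+1), (∑ v ∈ piAntidiag (univ : Finset (Fin (e+1))) n,
        (if ∑ i, v i = M then (M:ℝ) * D v else 0)) / ((n+e).choose e : ℝ) ≤ 1 := by
      rw [sum_eq_single_of_mem M (by simp)]
      · rw [div_le_one (by linarith)]
        refine le_trans (le_of_eq ?_) (hL.trans hN1)
        rw [mul_sum]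
        refine sum_congr rfl fun v hv => ?_
        rw [mem_piAntidiag] at hv
        rw [if_pos hv.1]
      · intro n _ hn
        rw [sum_eq_zero, zero_div]
        intro v hv
        rw [mem_piAntidiag] at hv
        rw [if_neg]; rw [hv.1]; exact hn
    linarith
  have htot := hp.trans hr
  rw [sum_add_distrib, ← sum_div] at htot
  have hge : (M:ℝ) * D (p M) ≤ ∑ n ∈ range (M+1), (if ∑ i, p n i = M then (M:ℝ) * D (p n) else 0) := by
    refine le_trans (le_of_eq ?_) (single_le_sum (f := fun n => (if ∑ i, p n i = M then (M:ℝ) * D (p n) else 0))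
      (fun n _ => ?_) (mem_range.2 (Nat.lt_succ_self M)))
    · simp [psum M le_rfl]
    · have := hD (p n)
      positivity
  have hS : 0 ≤ ∑ n ∈ range (M+1), D (p n) ^ ((1:ℝ) / ((e+1 : ℕ):ℝ)) :=
    sum_nonneg fun n _ => Real.rpow_nonneg (hD _).le _
  have hM0 : 0 ≤ (M:ℝ) * D (p M) := mul_nonneg (Nat.cast_nonneg _) (hD _).le
  constructor
  · rw [← div_le_iff₀ hTpos]
    linarith
  · have := div_nonneg hS hTpos.le
    linarith

lemma core (e : ℕ) (l : (Fin (e+1) → ℕ) → ℕ → ℝ) (D : (Fin (e+1) → ℕ) → ℝ)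
    (c C α : ℝ) (hc : 0 < c) (hC : 1 ≤ C) (hα : 0 < α)
    (hl : ∀ v k, 0 < l v k) (hD : ∀ v, 0 < D v)
    (h1 : ∀ v j k, Real.exp (-(c * D (v + Pi.single j 1) ^ ((1:ℝ) / ((e+1 : ℕ):ℝ)))) *
      (l (v + Pi.single j 1) k / l (v + Pi.single j 1) 0) ≤ l v k / l v 0)
    (h2 : ∀ v k, (1 - C * D v ^ α) * l v k ≤ l v (k+1))
    (h3 : ∀ s : Finset (Fin (e+1) → ℕ), ∑ v ∈ s, D v ≤ 1)
    (h4 : ∀ K, ∑ k ∈ range K, l 0 k ≤ 1) : False := by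
  -- main inequality along a path
  have main : ∀ (M : ℕ) (p : ℕ → (Fin (e+1) → ℕ)), p 0 = 0 →
      (∀ n < M, ∃ j, p (n+1) = p n + Pi.single j 1) →
      l 0 0 ≤ 4 * C * Real.exp (c * ∑ n ∈ range (M+1), D (p n) ^ ((1:ℝ) / ((e+1 : ℕ):ℝ)))
        * D (p M) ^ α := by
    intro M p p0 pst
    have chain : ∀ m ≤ M, ∀ k, Real.exp (-(c * ∑ n ∈ range (m+1),
        D (p n) ^ ((1:ℝ) / ((e+1 : ℕ):ℝ)))) * (l (p m) k / l (p m) 0) ≤ l 0 k / l 0 0 := by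
      intro m
      induction m with
      | zero =>
        intro _ k
        have h0 : 0 ≤ l 0 k / l 0 0 := (div_pos (hl _ _) (hl _ _)).le
        rw [p0]
        refine mul_le_of_le_one_left h0 ?_
        rw [Real.exp_le_one_iff]
        have : 0 ≤ ∑ n ∈ range (0+1), D (p n) ^ ((1:ℝ) / ((e+1 : ℕ):ℝ)) :=
          sum_nonneg fun n _ => Real.rpow_nonneg (hD _).le _
        nlinarith
      | succ m ih =>
        intro hm k
        refine le_trans ?_ (ih (by omega) k)
        obtain ⟨j, hj⟩ := pst m (by omega)
        rw [sum_range_succ _ (m+1), mul_add, neg_add, Real.exp_add, mul_assoc]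
        refine mul_le_mul_of_nonneg_left ?_ (Real.exp_pos _).le
        rw [hj]
        exact h1 _ _ _
    set S := ∑ n ∈ range (M+1), D (p n) ^ ((1:ℝ) / ((e+1 : ℕ):ℝ)) with hS
    set δ := C * D (p M) ^ α with hδ
    have hδ0 : 0 < δ := mul_pos (by linarith) (Real.rpow_pos_of_pos (hD _) _)
    have hgoal : l 0 0 ≤ 4 * Real.exp (c * S) * δ → l 0 0 ≤ 4 * C * Real.exp (c * S) * D (p M) ^ α := by
      intro h; rw [hδ] at h; linarith
    apply hgoal
    have hl01 : l 0 0 ≤ 1 := by simpa using h4 1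
    have hSnn : 0 ≤ S := sum_nonneg fun n _ => Real.rpow_nonneg (hD _).le _
    have hexp1 : 1 ≤ Real.exp (c * S) := Real.one_le_exp (by positivity)
    rcases le_or_gt (1/2) δ with hbig | hsmall
    · nlinarith
    -- lower bound of the last-level ratios
    have hrat : ∀ k : ℕ, (1 - δ)^k ≤ l (p M) k / l (p M) 0 := by
      intro k
      induction k with
      | zero => rw [pow_zero, div_self (hl _ _).ne']
      | succ k ih =>
        rw [pow_succ, mul_comm]
        refine (mul_le_mul_of_nonneg_left ih (by linarith)).trans ?_
        rw [← mul_div_assoc]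
        exact div_le_div_of_nonneg_right (h2 _ _) (hl _ _).le
    set K := ⌊1/(2*δ)⌋₊ with hK
    have hK1 : (K:ℝ) ≤ 1/(2*δ) := Nat.floor_le (by positivity)
    have hK2 : 1/(2*δ) < (K:ℝ)+1 := Nat.lt_floor_add_one _
    have hterm : ∀ k ∈ range (K+1), Real.exp (-(c*S)) * (1/2) * l 0 0 ≤ l 0 k := by
      intro k hk
      rw [mem_range] at hk
      have hkK : (k:ℝ) ≤ K := by exact_mod_cast Nat.lt_succ_iff.1 hk
      have hb := one_add_mul_le_pow (show (-2:ℝ) ≤ -δ by linarith) k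
      have hkd : (k:ℝ) * δ ≤ 1/2 := by
        have : (k:ℝ) * δ ≤ 1/(2*δ) * δ := mul_le_mul_of_nonneg_right (hkK.trans hK1) hδ0.le
        refine this.trans (le_of_eq ?_)
        field_simp
      have h12 : 1/2 ≤ l (p M) k / l (p M) 0 := by
        refine le_trans ?_ (hrat k)
        rw [show 1 - δ = 1 + -δ by ring]
        refine le_trans ?_ hb
        linarith
      have := (mul_le_mul_of_nonneg_left h12 (Real.exp_pos (-(c*S))).le).trans (chain M le_rfl k)
      rwa [le_div_iff₀ (hl _ _)] at this
    have hsum := (card_nsmul_le_sum _ _ _ hterm).trans (h4 (K+1))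
    rw [card_range, nsmul_eq_mul] at hsum
    push_cast at hsum
    have hpos : 0 < Real.exp (-(c*S)) * (1/2) * l 0 0 := by
      have := hl 0 0
      positivity
    have hfin : 1/(2*δ) * (Real.exp (-(c*S)) * (1/2) * l 0 0) ≤ 1 :=
      (mul_le_mul_of_nonneg_right hK2.le hpos.le).trans hsum
    rw [Real.exp_neg] at hfin
    have he := Real.exp_pos (c*S)
    have hrew : 1/(2*δ) * ((Real.exp (c*S))⁻¹ * (1/2) * l 0 0) = l 0 0 / (4 * Real.exp (c*S) * δ) := by
      field_simp; ring
    rw [hrew, div_le_one (by positivity)] at hfin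
    exact hfin
  -- choose epsilon and conclude
  set ε := α / (4*c) with hε
  have hε0 : 0 < ε := by positivity
  set A := (ε⁻¹)^e * (e.factorial : ℝ) with hA
  set Q := 4 * C * Real.exp (2 * c * (A + ε)) * (2:ℝ)^(α/2) * 2 ^ α with hQ
  have hlim : Filter.Tendsto (fun M : ℕ => Q * (M:ℝ) ^ (-(α/2))) Filter.atTop (nhds 0) := by
    have := ((tendsto_rpow_neg_atTop (half_pos hα)).comp tendsto_natCast_atTop_atTop).const_mul Q
    simpa using this
  obtain ⟨M1, hM1⟩ := Filter.eventually_atTop.1 (hlim.eventually (gt_mem_nhds (hl 0 0)))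
  obtain ⟨M, hM, p, p0, pst, hS, hMD⟩ := good_path e D hD h3 ε hε0 (M1 + 1)
  have hmain := main M p p0 pst
  have hMpos : (1:ℝ) ≤ M := by exact_mod_cast (show 1 ≤ M by omega)
  have hM0 : (0:ℝ) < M := by linarith
  have hlt := hM1 M (by omega)
  refine absurd hmain (not_le.2 (lt_of_le_of_lt ?_ hlt))
  have hDle : D (p M) ^ α ≤ 2 ^ α * (M:ℝ) ^ (-α) := by
    rw [Real.rpow_neg hM0.le, ← div_eq_mul_inv, ← Real.div_rpow (by norm_num) hM0.le]
    refine Real.rpow_le_rpow (hD _).le ?_ hα.le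
    rw [le_div_iff₀ hM0]; linarith
  have hexp : Real.exp (c * ∑ n ∈ range (M+1), D (p n) ^ ((1:ℝ) / ((e+1 : ℕ):ℝ)))
      ≤ Real.exp (2 * c * (A + ε)) * ((2:ℝ)^(α/2) * (M:ℝ)^(α/2)) := by
    rw [← Real.mul_rpow (by norm_num) hM0.le, Real.rpow_def_of_pos (by positivity), ← Real.exp_add,
      Real.exp_le_exp]
    have hlog : Real.log ((M:ℝ)+1) ≤ Real.log (2 * M) := Real.log_le_log (by positivity) (by linarith)
    have hce : 2 * c * ε = α/2 := by rw [hε]; field_simp; ring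
    calc _ ≤ c * (2 * (A + ε * (1 + Real.log (M+1)))) := mul_le_mul_of_nonneg_left hS hc.le
      _ = 2 * c * (A + ε) + (2 * c * ε) * Real.log (M+1) := by ring
      _ = 2 * c * (A + ε) + (α/2) * Real.log (M+1) := by rw [hce]
      _ ≤ 2 * c * (A + ε) + Real.log (2*M) * (α/2) := by
        rw [mul_comm (α/2)]; gcongr
  calc _ ≤ 4 * C * (Real.exp (2 * c * (A + ε)) * ((2:ℝ)^(α/2) * (M:ℝ)^(α/2))) *
        (2 ^ α * (M:ℝ) ^ (-α)) := by
        have := Real.rpow_nonneg (hD (p M)).le α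
        gcongr
    _ = Q * ((M:ℝ)^(α/2) * (M:ℝ)^(-α)) := by rw [hQ]; ring
    _ = Q * (M:ℝ)^(-(α/2)) := by
        rw [← Real.rpow_add hM0]; congr 2; ring

/-- Index of the `k`-th interval in the block `v`, shifted by `-N` in each coordinate. -/
def idx {d : ℕ} (N : ℕ) (v : Fin d → ℕ) (k : ℤ) : Fin (d + 1) → ℤ :=
  Fin.snoc (α := fun _ => ℤ) (fun i => -(N : ℤ) - (v i : ℤ)) k

lemma idx_last {d : ℕ} (N : ℕ) (v : Fin d → ℕ) (k : ℤ) : idx N v k (Fin.last d) = k := by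
  simp [idx]

lemma idx_castSucc {d : ℕ} (N : ℕ) (v : Fin d → ℕ) (k : ℤ) (i : Fin d) :
    idx N v k i.castSucc = -(N : ℤ) - (v i : ℤ) := by
  simp [idx]

lemma idx_update_last {d : ℕ} (N : ℕ) (v : Fin d → ℕ) (k m : ℤ) :
    Function.update (idx N v k) (Fin.last d) m = idx N v m := by
  funext i
  refine Fin.lastCases ?_ (fun i => ?_) i
  · simp [idx]
  · rw [Function.update_of_ne (Fin.castSucc_lt_last i).ne, idx_castSucc, idx_castSucc]

lemma idx_update_castSucc {d : ℕ} (N : ℕ) (v : Fin d → ℕ) (k : ℤ) (j : Fin d) :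
    Function.update (idx N (v + Pi.single j 1) k) j.castSucc
      (idx N (v + Pi.single j 1) k j.castSucc + 1) = idx N v k := by
  funext i
  refine Fin.lastCases ?_ (fun i => ?_) i
  · rw [Function.update_of_ne (Fin.castSucc_lt_last j).ne', idx_last, idx_last]
  · by_cases h : i = j
    · subst h
      rw [Function.update_self, idx_castSucc, idx_castSucc]
      simp; ring
    · rw [Function.update_of_ne (fun h' => h (Fin.castSucc_injective _ h')), idx_castSucc,
        idx_castSucc]
      simp [h]

lemma bounds {d : ℕ} (a b : (Fin (d + 1) → ℤ) → ℝ)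
    (hab : ∀ u, a u < b u)
    (hsub : ∀ u, Set.Icc (a u) (b u) ⊆ Set.Icc (0 : ℝ) 1)
    (u) : 0 ≤ a u ∧ b u ≤ 1 :=
  ⟨(hsub u ⟨le_rfl, (hab u).le⟩).1, (hsub u ⟨(hab u).le, le_rfl⟩).2⟩

lemma lex_update {d : ℕ} (a b : (Fin (d + 1) → ℤ) → ℝ)
    (hlex : ∀ u v : Fin (d + 1) → ℤ,
      (∃ k, (∀ m, m < k → u m = v m) ∧ u k < v k) → b u < a v)
    (u : Fin (d+1) → ℤ) (j) (m n : ℤ) (h : m < n) :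
    b (Function.update u j m) < a (Function.update u j n) := by
  refine hlex _ _ ⟨j, fun i hi => ?_, by simpa using h⟩
  rw [Function.update_of_ne hi.ne, Function.update_of_ne hi.ne]

lemma grow {d : ℕ} (a b : (Fin (d + 1) → ℤ) → ℝ)
    (hab : ∀ u, a u < b u)
    (hsub : ∀ u, Set.Icc (a u) (b u) ⊆ Set.Icc (0 : ℝ) 1)
    (hlex : ∀ u v : Fin (d + 1) → ℤ,
      (∃ k, (∀ m, m < k → u m = v m) ∧ u k < v k) → b u < a v)
    (f : Fin (d + 1) → ℝ → ℝ)
    (hC1 : ∀ j, ContDiffOn ℝ 1 (f j) (Set.Icc (0 : ℝ) 1))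
    (hmap : ∀ (j : Fin (d + 1)) (u : Fin (d + 1) → ℤ),
      f j '' Set.Icc (a u) (b u)
        = Set.Icc (a (Function.update u j (u j + 1))) (b (Function.update u j (u j + 1))))
    (j : Fin (d+1)) (u : Fin (d+1) → ℤ) : ∃ n : ℕ,
    ∃ ξ ∈ Set.Icc (a (Function.update u j (u j - n))) (b (Function.update u j (u j - n))),
      1 ≤ |derivWithin (f j) (Set.Icc 0 1) ξ| := by
  by_contra! hcon
  set U : ℕ → (Fin (d+1) → ℤ) := fun n => Function.update u j (u j - n) with hU
  have hstep : ∀ n, Function.update (U (n+1)) j (U (n+1) j + 1) = U n := by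
    intro n
    simp only [hU, Function.update_self, Function.update_idem]
    congr 1
    push_cast; ring
  have hge : ∀ n, b (U 0) - a (U 0) ≤ b (U n) - a (U n) := by
    intro n
    induction n with
    | zero => exact le_rfl
    | succ n ih =>
      refine ih.trans ?_
      have him := hmap j (U (n+1))
      rw [hstep] at him
      obtain ⟨ξ, hξ, h⟩ := (mvt_image (f j) (hC1 j) _ _ _ _ (bounds a b hab hsub _).1 (hab (U (n+1)))
        (bounds a b hab hsub _).2 (hab (U n)) him).2
      refine h.trans (mul_le_of_le_one_left (sub_nonneg.2 (hab _).le) (hcon (n+1) ξ hξ).le)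
  have hsum : ∀ K : ℕ, K * (b (U 0) - a (U 0)) ≤ 1 := by
    intro K
    refine le_trans ?_ (sum_le_one (range K) (fun n => a (U n)) (fun n => b (U n))
      (fun n _ => (bounds a b hab hsub _).1) (fun n _ => (bounds a b hab hsub _).2)
      (fun n _ => (hab _).le) (fun m _ n _ hmn => ?_))
    · have := card_nsmul_le_sum (range K) (fun n => b (U n) - a (U n)) _ (fun n _ => hge n)
      rwa [card_range, nsmul_eq_mul] at this
    · rcases lt_or_gt_of_ne hmn with h | h
      · right
        exact (lex_update a b hlex u j _ _ (by omega)).le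
      · left
        exact (lex_update a b hlex u j _ _ (by omega)).le
  have hpos := sub_pos.2 (hab (U 0))
  obtain ⟨K, hK⟩ := exists_nat_gt (1 / (b (U 0) - a (U 0)))
  rw [div_lt_iff₀ hpos] at hK
  linarith [hsum K]

lemma lower {d : ℕ} (a b : (Fin (d + 1) → ℤ) → ℝ)
    (hab : ∀ u, a u < b u)
    (hsub : ∀ u, Set.Icc (a u) (b u) ⊆ Set.Icc (0 : ℝ) 1)
    (hlex : ∀ u v : Fin (d + 1) → ℤ,
      (∃ k, (∀ m, m < k → u m = v m) ∧ u k < v k) → b u < a v)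
    (f : Fin (d + 1) → ℝ → ℝ)
    (hC1 : ∀ j, ContDiffOn ℝ 1 (f j) (Set.Icc (0 : ℝ) 1))
    (hmap : ∀ (j : Fin (d + 1)) (u : Fin (d + 1) → ℤ),
      f j '' Set.Icc (a u) (b u)
        = Set.Icc (a (Function.update u j (u j + 1))) (b (Function.update u j (u j + 1))))
    (β C : ℝ) (hβ : 0 < β) (hC : 0 ≤ C) (S : Set (Fin (d+1)))
    (hH : ∀ j ∈ S, ∀ x ∈ Set.Icc (0 : ℝ) 1, ∀ y ∈ Set.Icc (0 : ℝ) 1,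
      |derivWithin (f j) (Set.Icc (0 : ℝ) 1) x
        - derivWithin (f j) (Set.Icc (0 : ℝ) 1) y| ≤ C * |x - y| ^ β) :
    ∃ N : ℕ, ∀ j ∈ S, ∀ u : Fin (d+1) → ℤ, u 0 ≤ -(N:ℤ) → ∀ x ∈ Set.Icc (a u) (b u),
      1/2 ≤ |derivWithin (f j) (Set.Icc 0 1) x| := by
  set s : ℕ → ℝ := fun n => a (fun _ => -(n:ℤ)) with hs
  have hanti : Antitone s := by
    refine antitone_nat_of_succ_le fun n => ?_
    refine (hab _).le.trans (hlex _ _ ⟨0, fun m hm => absurd hm (Fin.not_lt_zero m), ?_⟩).le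
    push_cast; omega
  have hbdd : BddBelow (Set.range s) := ⟨0, by
    rintro _ ⟨n, rfl⟩
    exact (bounds a b hab hsub _).1⟩
  have hlim := tendsto_atTop_ciInf hanti hbdd
  set L := ⨅ n, s n with hL
  have hlim2 : Filter.Tendsto (fun n => C * (s n - L)^β) Filter.atTop (nhds 0) := by
    have h1 : Filter.Tendsto (fun n => s n - L) Filter.atTop (nhds 0) := by
      simpa using hlim.sub_const L
    have h2 := (h1.rpow_const (Or.inr hβ.le)).const_mul C
    rwa [Real.zero_rpow hβ.ne', mul_zero] at h2
  obtain ⟨n, hn⟩ := (hlim2.eventually (gt_mem_nhds (show (0:ℝ) < 1/2 by norm_num))).exists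
  have hloc : ∀ u : Fin (d+1) → ℤ, u 0 ≤ -((n+1 : ℕ):ℤ) → ∀ x ∈ Set.Icc (a u) (b u),
      x ∈ Set.Icc L (s n) := by
    intro u hu x hx
    constructor
    · have h1 : L ≤ s ((-(u 0) + 1).toNat) := ciInf_le hbdd _
      refine h1.trans (le_trans ?_ hx.1)
      refine (hab _).le.trans (hlex _ _ ⟨0, fun m hm => absurd hm (Fin.not_lt_zero m), ?_⟩).le
      omega
    · refine hx.2.trans (hlex _ _ ⟨0, fun m hm => absurd hm (Fin.not_lt_zero m), ?_⟩).le
      push_cast at hu; omega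
  refine ⟨n+1, fun j hj u hu x hx => ?_⟩
  obtain ⟨m, ξ, hξ, h1⟩ := grow a b hab hsub hlex f hC1 hmap j u
  have hu' : Function.update u j (u j - m) 0 ≤ -((n+1 : ℕ):ℤ) := by
    by_cases h : (0 : Fin (d+1)) = j
    · subst h; rw [Function.update_self]; omega
    · rwa [Function.update_of_ne h]
  have hx' := hloc u hu x hx
  have hξ' := hloc _ hu' ξ hξ
  have hd := hH j hj ξ (hsub _ hξ) x (hsub _ hx)
  have habs : |ξ - x| ≤ s n - L := by
    rw [abs_le]; constructor <;> linarith [hx'.1, hx'.2, hξ'.1, hξ'.2]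
  have h2 : C * |ξ - x| ^ β ≤ C * (s n - L)^β :=
    mul_le_mul_of_nonneg_left (Real.rpow_le_rpow (abs_nonneg _) habs hβ.le) hC
  have h3 := abs_sub_abs_le_abs_sub (derivWithin (f j) (Set.Icc 0 1) ξ) (derivWithin (f j) (Set.Icc 0 1) x)
  linarith

lemma lex_idx {d : ℕ} (a b : (Fin (d + 1) → ℤ) → ℝ)
    (hlex : ∀ u v : Fin (d + 1) → ℤ,
      (∃ k, (∀ m, m < k → u m = v m) ∧ u k < v k) → b u < a v)
    (N : ℕ) (v v' : Fin d → ℕ) (h : v ≠ v') :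
    (∀ k k', b (idx N v k) < a (idx N v' k')) ∨ (∀ k k', b (idx N v' k) < a (idx N v k')) := by
  have hne : (univ.filter fun i => v i ≠ v' i).Nonempty := by
    obtain ⟨i, hi⟩ := Function.ne_iff.1 h
    exact ⟨i, by simpa using hi⟩
  set i := (univ.filter fun i => v i ≠ v' i).min' hne with hi
  have hmem := (univ.filter fun i => v i ≠ v' i).min'_mem hne
  rw [← hi, mem_filter] at hmem
  have hlt : ∀ m, m < i → v m = v' m := by
    intro m hm
    by_contra hcon
    exact absurd (Finset.min'_le _ m (by simpa using hcon)) (not_le.2 hm)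
  have key : ∀ w w' : Fin d → ℕ, (∀ m, m < i → w m = w' m) → w' i < w i →
      ∀ k k', b (idx N w k) < a (idx N w' k') := by
    intro w w' h1 h2 k k'
    refine hlex _ _ ⟨i.castSucc, ?_, ?_⟩
    · intro m
      refine Fin.lastCases ?_ (fun m => ?_) m
      · intro hm
        exact absurd (hm.trans (Fin.castSucc_lt_last i)) (lt_irrefl _)
      · intro hm
        rw [idx_castSucc, idx_castSucc, h1 m (by simpa using hm)]
    · rw [idx_castSucc, idx_castSucc]; omega
  rcases lt_or_gt_of_ne hmem.2 with h' | h'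
  · right; exact key v' v (fun m hm => (hlt m hm).symm) h'
  · left; exact key v v' hlt h'


end GK

/-- **Generalized Kopell Lemma in critical regularity (Theorem A).**
Let `d ≥ 1` and let `{I_u : u ∈ ℤ^(d+1)}` (here `I_u = [a u, b u]`) be a family of
pairwise disjoint nondegenerate closed subintervals of `[0,1]` disposed respecting the
lexicographic order.  Let `f 0, …, f d` be `C¹` diffeomorphisms of `[0,1]` onto itself
such that `f j` shifts the `j`-th index of the family of intervals by one.  If the last
map `f (Fin.last d)` is of class `C^{1+α}` for some `α > 0` and commutes with the other
maps, then the maps `f 0, …, f (d-1)` cannot all be of class `C^{1+1/d}`. -/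
theorem generalized_kopell_critical
    (d : ℕ) (hd : 1 ≤ d)
    (a b : (Fin (d + 1) → ℤ) → ℝ)
    (hab : ∀ u, a u < b u)
    (hsub : ∀ u, Set.Icc (a u) (b u) ⊆ Set.Icc (0 : ℝ) 1)
    (hlex : ∀ u v : Fin (d + 1) → ℤ,
      (∃ k, (∀ m, m < k → u m = v m) ∧ u k < v k) → b u < a v)
    (f : Fin (d + 1) → ℝ → ℝ)
    (hbij : ∀ j, Set.BijOn (f j) (Set.Icc (0 : ℝ) 1) (Set.Icc (0 : ℝ) 1))
    (hC1 : ∀ j, ContDiffOn ℝ 1 (f j) (Set.Icc (0 : ℝ) 1))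
    (hmap : ∀ (j : Fin (d + 1)) (u : Fin (d + 1) → ℤ),
      f j '' Set.Icc (a u) (b u)
        = Set.Icc (a (Function.update u j (u j + 1))) (b (Function.update u j (u j + 1))))
    (α : ℝ) (hα : 0 < α)
    (hlast : ∃ C : ℝ, ∀ x ∈ Set.Icc (0 : ℝ) 1, ∀ y ∈ Set.Icc (0 : ℝ) 1,
      |derivWithin (f (Fin.last d)) (Set.Icc (0 : ℝ) 1) x
        - derivWithin (f (Fin.last d)) (Set.Icc (0 : ℝ) 1) y| ≤ C * |x - y| ^ α)
    (hcomm : ∀ i : Fin d, ∀ x ∈ Set.Icc (0 : ℝ) 1,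
      f (Fin.last d) (f i.castSucc x) = f i.castSucc (f (Fin.last d) x)) :
    ¬ (∀ i : Fin d, ∃ C : ℝ, ∀ x ∈ Set.Icc (0 : ℝ) 1, ∀ y ∈ Set.Icc (0 : ℝ) 1,
      |derivWithin (f i.castSucc) (Set.Icc (0 : ℝ) 1) x
        - derivWithin (f i.castSucc) (Set.Icc (0 : ℝ) 1) y|
          ≤ C * |x - y| ^ ((1 : ℝ) / d)) := by
  obtain ⟨e, rfl⟩ : ∃ e, d = e + 1 := ⟨d - 1, by omega⟩
  intro hcon
  choose Cj hCj using hcon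
  obtain ⟨Cl, hCl⟩ := hlast
  set β : ℝ := (1:ℝ) / ((e+1 : ℕ):ℝ) with hβ
  have hβ0 : 0 < β := by positivity
  set C0 : ℝ := 1 + ∑ j, |Cj j| with hC0
  have hC0pos : 0 < C0 := by
    have : 0 ≤ ∑ j, |Cj j| := Finset.sum_nonneg fun j _ => abs_nonneg _
    linarith
  have hH : ∀ j : Fin (e+1), ∀ x ∈ Set.Icc (0 : ℝ) 1, ∀ y ∈ Set.Icc (0 : ℝ) 1,
      |derivWithin (f j.castSucc) (Set.Icc (0 : ℝ) 1) x
        - derivWithin (f j.castSucc) (Set.Icc (0 : ℝ) 1) y| ≤ C0 * |x - y| ^ β := by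
    intro j x hx y hy
    refine (hCj j x hx y hy).trans (mul_le_mul_of_nonneg_right ?_ (Real.rpow_nonneg (abs_nonneg _) _))
    have := Finset.single_le_sum (f := fun j => |Cj j|) (fun j _ => abs_nonneg _) (Finset.mem_univ j)
    have h2 := le_abs_self (Cj j)
    linarith
  obtain ⟨N, hN⟩ := GK.lower a b hab hsub hlex f hC1 hmap β C0 hβ0 hC0pos.le
    (Set.range Fin.castSucc) (by rintro _ ⟨j, rfl⟩; exact hH j)
  have hN' : ∀ (j : Fin (e+1)) (v : Fin (e+1) → ℕ) (k : ℤ),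
      ∀ x ∈ Set.Icc (a (GK.idx N v k)) (b (GK.idx N v k)),
      1/2 ≤ |derivWithin (f j.castSucc) (Set.Icc 0 1) x| := by
    intro j v k x hx
    refine hN _ ⟨j, rfl⟩ _ ?_ x hx
    rw [← Fin.castSucc_zero, GK.idx_castSucc]
    omega
  have hbd := GK.bounds a b hab hsub
  set A : (Fin (e+1) → ℕ) → ℝ := fun v => ⨅ k : ℤ, a (GK.idx N v k) with hA
  set B : (Fin (e+1) → ℕ) → ℝ := fun v => ⨆ k : ℤ, b (GK.idx N v k) with hB
  have hAle : ∀ v k, A v ≤ a (GK.idx N v k) := fun v k =>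
    ciInf_le ⟨0, by rintro _ ⟨k, rfl⟩; exact (hbd _).1⟩ k
  have hleB : ∀ v k, b (GK.idx N v k) ≤ B v := fun v k =>
    le_ciSup (f := fun k : ℤ => b (GK.idx N v k)) ⟨1, by rintro _ ⟨k, rfl⟩; exact (hbd _).2⟩ k
  have hA0 : ∀ v, 0 ≤ A v := fun v => le_ciInf fun k => (hbd _).1
  have hB1 : ∀ v, B v ≤ 1 := fun v => ciSup_le fun k => (hbd _).2
  have hABlt : ∀ v, A v < B v := fun v =>
    lt_of_le_of_lt (hAle v 0) (lt_of_lt_of_le (hab _) (hleB v 0))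
  have hdist : ∀ v k k' x y, x ∈ Set.Icc (a (GK.idx N v k)) (b (GK.idx N v k)) →
      y ∈ Set.Icc (a (GK.idx N v k')) (b (GK.idx N v k')) → |x - y| ≤ B v - A v := by
    intro v k k' x y hx hy
    rw [abs_le]
    constructor <;> linarith [hx.1, hx.2, hy.1, hy.2, hAle v k, hAle v k', hleB v k, hleB v k']
  have hmv := fun (j : Fin (e+1+1)) (u u' : Fin (e+1+1) → ℤ)
      (h : Function.update u j (u j + 1) = u') =>
    GK.mvt_image (f j) (hC1 j) (a u) (b u) (a u') (b u') (hbd u).1 (hab u) (hbd u).2 (hab u')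
      (h ▸ hmap j u)
  refine GK.core e (fun v k => b (GK.idx N v k) - a (GK.idx N v k)) (fun v => B v - A v)
    (2 * C0) (max 1 Cl) α (by positivity) (le_max_left _ _) hα
    (fun v k => sub_pos.2 (hab _)) (fun v => sub_pos.2 (hABlt v)) ?_ ?_ ?_ ?_
  · intro v j k
    set w := v + Pi.single j 1 with hw
    obtain ⟨ξ, hξ, h1⟩ := (hmv j.castSucc _ _ (GK.idx_update_castSucc N v (k:ℤ) j)).1
    obtain ⟨η, hη, h2⟩ := (hmv j.castSucc _ _ (GK.idx_update_castSucc N v ((0:ℕ):ℤ) j)).2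
    rw [← hw] at hξ h1 hη h2
    have hhalf := hN' j w k ξ hξ
    have hdd := hH j η (hsub _ hη) ξ (hsub _ hξ)
    have hds := hdist w _ _ η ξ hη hξ
    have h3 : C0 * |η - ξ| ^ β ≤ C0 * (B w - A w) ^ β :=
      mul_le_mul_of_nonneg_left (Real.rpow_le_rpow (abs_nonneg _) hds hβ0.le) hC0pos.le
    have h4 := abs_sub_abs_le_abs_sub (derivWithin (f j.castSucc) (Set.Icc 0 1) η)
      (derivWithin (f j.castSucc) (Set.Icc 0 1) ξ)
    set P := |derivWithin (f j.castSucc) (Set.Icc 0 1) ξ| with hP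
    set Q := |derivWithin (f j.castSucc) (Set.Icc 0 1) η| with hQ
    set Y := (B w - A w) ^ β with hY
    have hY0 : 0 ≤ Y := Real.rpow_nonneg (sub_pos.2 (hABlt w)).le _
    have hexp : Q ≤ P * Real.exp (2 * C0 * Y) := by
      have h5 := Real.add_one_le_exp (2 * C0 * Y)
      have h6 : P * (2 * C0 * Y + 1) ≤ P * Real.exp (2 * C0 * Y) :=
        mul_le_mul_of_nonneg_left h5 (by linarith)
      have h7 : 0 ≤ (P - 1/2) * (C0 * Y) := mul_nonneg (by linarith) (by positivity)
      nlinarith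
    have p1 := sub_pos.2 (hab (GK.idx N w (k:ℤ)))
    have p2 := sub_pos.2 (hab (GK.idx N w ((0:ℕ):ℤ)))
    have p3 := sub_pos.2 (hab (GK.idx N v (k:ℤ)))
    have p4 := sub_pos.2 (hab (GK.idx N v ((0:ℕ):ℤ)))
    set x := b (GK.idx N w (k:ℤ)) - a (GK.idx N w (k:ℤ))
    set x0 := b (GK.idx N w ((0:ℕ):ℤ)) - a (GK.idx N w ((0:ℕ):ℤ))
    set y := b (GK.idx N v (k:ℤ)) - a (GK.idx N v (k:ℤ))
    set y0 := b (GK.idx N v ((0:ℕ):ℤ)) - a (GK.idx N v ((0:ℕ):ℤ))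
    rw [← mul_div_assoc, div_le_div_iff₀ p2 p4]
    have hE := Real.exp_pos (2 * C0 * Y)
    rw [Real.exp_neg]
    calc (Real.exp (2 * C0 * Y))⁻¹ * x * y0 ≤ (Real.exp (2 * C0 * Y))⁻¹ * x *
          ((P * Real.exp (2 * C0 * Y)) * x0) := by
          refine mul_le_mul_of_nonneg_left (h2.trans ?_) (by positivity)
          exact mul_le_mul_of_nonneg_right hexp p2.le
      _ = (P * x) * x0 := by field_simp
      _ ≤ y * x0 := mul_le_mul_of_nonneg_right h1 p2.le
  · intro v k
    obtain ⟨n, ξ, hξ, h1⟩ := GK.grow a b hab hsub hlex f hC1 hmap (Fin.last (e+1)) (GK.idx N v 0)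
    rw [GK.idx_update_last] at hξ
    have hu : Function.update (GK.idx N v (k:ℤ)) (Fin.last (e+1))
        (GK.idx N v (k:ℤ) (Fin.last (e+1)) + 1) = GK.idx N v ((k+1 : ℕ) : ℤ) := by
      rw [GK.idx_update_last, GK.idx_last]; push_cast; rfl
    obtain ⟨η, hη, h2⟩ := (hmv _ _ _ hu).1
    refine le_trans (mul_le_mul_of_nonneg_right ?_ (sub_pos.2 (hab _)).le) h2
    have hdd := hCl ξ (hsub _ hξ) η (hsub _ hη)
    have hds := hdist v _ _ ξ η hξ hη
    have h3 : Cl * |ξ - η| ^ α ≤ max 1 Cl * (B v - A v) ^ α :=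
      mul_le_mul (le_max_right _ _) (Real.rpow_le_rpow (abs_nonneg _) hds hα.le)
        (Real.rpow_nonneg (abs_nonneg _) _) (le_trans zero_le_one (le_max_left _ _))
    have h4 := abs_sub_abs_le_abs_sub (derivWithin (f (Fin.last (e+1))) (Set.Icc 0 1) ξ)
      (derivWithin (f (Fin.last (e+1))) (Set.Icc 0 1) η)
    linarith
  · intro s
    refine GK.sum_le_one s A B (fun v _ => hA0 v) (fun v _ => hB1 v) (fun v _ => (hABlt v).le) ?_
    intro v _ v' _ hne
    rcases GK.lex_idx a b hlex N v v' hne with h | h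
    · left
      exact ciSup_le fun k => le_ciInf fun k' => (h k k').le
    · right
      exact ciSup_le fun k => le_ciInf fun k' => (h k k').le
  · intro K
    refine GK.sum_le_one (Finset.range K) (fun k => a (GK.idx N 0 (k:ℤ)))
      (fun k => b (GK.idx N 0 (k:ℤ))) (fun k _ => (hbd _).1) (fun k _ => (hbd _).2)
      (fun k _ => (hab _).le) ?_
    have key : ∀ m n : ℕ, m < n → b (GK.idx N (0 : Fin (e+1) → ℕ) (m:ℤ)) ≤ a (GK.idx N 0 (n:ℤ)) := by
      intro m n hmn
      have := GK.lex_update a b hlex (GK.idx N (0 : Fin (e+1) → ℕ) 0) (Fin.last (e+1)) m n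
        (by exact_mod_cast hmn)
      rw [GK.idx_update_last, GK.idx_update_last] at this
      exact this.le
    intro m _ n _ hne
    rcases lt_or_gt_of_ne hne with h | h
    · exact Or.inl (key m n h)
    · exact Or.inr (key n m h)
end

section
/- Let d ≥ 1 and let {I_{i_1,…,i_{d+1}} : (i_1,…,i_{d+1}) ∈ ℤ^{d+1}} be a family of pairwise disjoint nondegenerate closed subintervals of [0,1] disposed respecting the lexicographic order. Let f_1,…,f_{d+1} be diffeomorphisms of [0,1] onto itself such that for every 1 ≤ j ≤ d+1 and every (i_1,…,i_{d+1}) ∈ ℤ^{d+1} one has f_j(I_{i_1,…,i_{j-1},i_j,i_{j+1},…,i_{d+1}}) = I_{i_1,…,i_{j-1},1+i_j,i_{j+1},…,i_{d+1}}. Assume each f_i with 1 ≤ i ≤ d is of class C^{1+α_i} for some 0 < α_i ≤ 1, and that f_{d+1} is of class C^{1+α_{d+1}} for some α_{d+1} > 0 and commutes with each of f_1,…,f_d. Then α_1 + α_2 + ⋯ + α_d < 1. -/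
theorem gk_jensen {ι : Type*} (F : Finset ι) (l : ι → ℝ) (hl : ∀ x, 0 ≤ l x) (α ε : ℝ)
    (h0 : 0 < α) (h1 : α ≤ 1) (hF : ∑ x ∈ F, l x ≤ ε) (hne : F.Nonempty) :
    (∑ x ∈ F, l x ^ α) ≤ (F.card : ℝ) * ((F.card : ℝ) ^ (-α) * ε ^ α) := by
  have hc : (0 : ℝ) < F.card := by exact_mod_cast hne.card_pos
  have hs : 0 ≤ ∑ x ∈ F, l x := Finset.sum_nonneg (fun x _ => hl x)
  have key := Real.arith_mean_le_rpow_mean F (fun _ => (F.card : ℝ)⁻¹) (fun x => l x ^ α)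
    (fun _ _ => by positivity) (by simp; field_simp) (fun x _ => Real.rpow_nonneg (hl x) _)
    (p := 1 / α) (by rw [le_div_iff₀ h0]; linarith)
  have e1 : ∀ x, (l x ^ α) ^ α⁻¹ = l x := fun x => by
    rw [← Real.rpow_mul (hl x)]; field_simp; simp
  simp only [one_div, inv_inv, e1, ← Finset.mul_sum] at key
  rw [Real.mul_rpow (by positivity) hs, Real.inv_rpow hc.le, ← Real.rpow_neg hc.le] at key
  have h2 : (∑ x ∈ F, l x) ^ α ≤ ε ^ α := Real.rpow_le_rpow hs hF h0.le
  have h3 : (F.card : ℝ) ^ (-α) * (∑ x ∈ F, l x) ^ α ≤ (F.card : ℝ) ^ (-α) * ε ^ α := by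
    gcongr
  have h4 := key.trans h3
  rw [inv_mul_le_iff₀ hc] at h4
  exact h4

/-- one-dimensional averages -/
theorem gk_avg1 (g w : ℕ → ℝ) (n n' : ℕ) (hn : 0 < n) (hnn : n ≤ n')
    (hw : ∀ t, 0 ≤ w t)
    (hg : ∀ t, |g (t + 1) - g t| ≤ w t + w (t + 1)) :
    |(∑ t ∈ Finset.range n, g t) / n - (∑ t ∈ Finset.range n', g t) / n'|
      ≤ 2 * ∑ t ∈ Finset.range n', w t := by
  have hB : ∀ m, ∀ t ≤ m, |g m - g t| + w m ≤ 2 * ∑ r ∈ Finset.range (m + 1), w r := by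
    intro m
    induction m with
    | zero =>
      intro t ht
      obtain rfl : t = 0 := by omega
      simp; linarith [hw 0]
    | succ m ih =>
      intro t ht
      rw [Finset.sum_range_succ]
      rcases Nat.lt_or_ge m t with h | h
      · obtain rfl : t = m + 1 := by omega
        have : 0 ≤ ∑ r ∈ Finset.range (m + 1), w r := Finset.sum_nonneg fun r _ => hw r
        simp; linarith [hw (m + 1)]
      · have := ih t h
        have h2 := abs_sub_le (g (m + 1)) (g m) (g t)
        linarith [hg m]
  have hB2 : ∀ m < n', ∀ t < n', |g m - g t| ≤ 2 * ∑ r ∈ Finset.range n', w r := by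
    have aux : ∀ m < n', ∀ t ≤ m, |g m - g t| ≤ 2 * ∑ r ∈ Finset.range n', w r := by
      intro m hm t ht
      have h1 := hB m t ht
      have h2 : ∑ r ∈ Finset.range (m + 1), w r ≤ ∑ r ∈ Finset.range n', w r :=
        Finset.sum_le_sum_of_subset_of_nonneg (by simp; omega) (fun r _ _ => hw r)
      linarith [hw m]
    intro m hm t ht
    rcases le_total t m with h | h
    · exact aux m hm t h
    · rw [abs_sub_comm]; exact aux t ht m h
  have hn0 : (0 : ℝ) < n := by exact_mod_cast hn
  have hn0' : (0 : ℝ) < n' := by exact_mod_cast hn.trans_le hnn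
  set W := 2 * ∑ r ∈ Finset.range n', w r with hW
  have e : (∑ t ∈ Finset.range n, g t) / n - (∑ t ∈ Finset.range n', g t) / n'
      = (∑ t ∈ Finset.range n, ∑ r ∈ Finset.range n', (g t - g r)) / (n * n') := by
    simp only [Finset.sum_sub_distrib, Finset.sum_const, Finset.card_range, nsmul_eq_mul,
      ← Finset.mul_sum]
    field_simp
  rw [e, abs_div, abs_of_pos (mul_pos hn0 hn0'), div_le_iff₀ (by positivity)]
  calc |∑ t ∈ Finset.range n, ∑ r ∈ Finset.range n', (g t - g r)|
      ≤ ∑ t ∈ Finset.range n, ∑ r ∈ Finset.range n', |g t - g r| :=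
        (Finset.abs_sum_le_sum_abs _ _).trans
          (Finset.sum_le_sum fun t _ => Finset.abs_sum_le_sum_abs _ _)
    _ ≤ ∑ t ∈ Finset.range n, ∑ r ∈ Finset.range n', W := by
        refine Finset.sum_le_sum fun t ht => Finset.sum_le_sum fun r hr => ?_
        simp at ht hr
        exact hB2 t (by omega) r hr
    _ = W * (n * n') := by simp; ring

def gkBox {e : ℕ} (L : Fin e → ℕ) : Finset (Fin e → ℕ) :=
  Fintype.piFinset (fun i => Finset.range (L i))

theorem gk_box_card {e : ℕ} (L : Fin e → ℕ) : (gkBox L).card = ∏ i, L i := by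
  simp [gkBox]

theorem gk_box_split {e : ℕ} (i : Fin (e + 1)) (L : Fin (e + 1) → ℕ) (G : (Fin (e + 1) → ℕ) → ℝ) :
    ∑ x ∈ gkBox L, G x
      = ∑ y ∈ gkBox (i.removeNth L), ∑ t ∈ Finset.range (L i), G (i.insertNth t y) := by
  rw [← Finset.sum_product']
  symm
  refine Finset.sum_bij' (fun p _ => i.insertNth (α := fun _ => ℕ) p.2 p.1)
    (fun x _ => (i.removeNth x, x i)) ?_ ?_ ?_ ?_ ?_
  · rintro ⟨y, t⟩ h
    simp [gkBox] at h ⊢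
    intro j
    rcases Fin.eq_self_or_eq_succAbove i j with rfl | ⟨k, rfl⟩
    · simpa using h.2
    · simpa [Fin.removeNth] using h.1 k
  · intro x h
    simp [gkBox] at h ⊢
    exact ⟨fun j => h _, h _⟩
  · rintro ⟨y, t⟩ h
    simp
  · intro x h
    simp
  · rintro ⟨y, t⟩ h
    rfl

noncomputable def gkAvg {e : ℕ} (G : (Fin e → ℕ) → ℝ) (L : Fin e → ℕ) : ℝ :=
  (∑ x ∈ gkBox L, G x) / (gkBox L).card

theorem gk_step {e : ℕ} (i : Fin (e + 1)) (L : Fin (e + 1) → ℕ) (hL : ∀ j, 0 < L j)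
    (n' : ℕ) (hn : L i ≤ n') (G l : (Fin (e + 1) → ℕ) → ℝ) (hl : ∀ x, 0 ≤ l x)
    (α ε C : ℝ) (hC : 0 ≤ C)
    (h0 : 0 < α) (h1 : α ≤ 1) (hF : ∀ F : Finset (Fin (e + 1) → ℕ), ∑ x ∈ F, l x ≤ ε)
    (hG : ∀ x, |G (Function.update x i (x i + 1)) - G x|
      ≤ C * (l x ^ α + l (Function.update x i (x i + 1)) ^ α)) :
    |gkAvg G L - gkAvg G (Function.update L i n')|
      ≤ 2 * C * (n' * (((∏ j, Function.update L i n' j : ℕ) : ℝ) ^ (-α) * ε ^ α)) := by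
  set L' := Function.update L i n' with hL'
  have hrem : i.removeNth L' = i.removeNth L := by
    funext j; simp [Fin.removeNth, hL']
  have hi : L' i = n' := by simp [hL']
  set Y := gkBox (i.removeNth L) with hY
  have hYne : Y.Nonempty := by
    rw [← Finset.card_pos, hY, gk_box_card]
    exact Finset.prod_pos fun j _ => hL _
  have hYpos : (0 : ℝ) < Y.card := by exact_mod_cast hYne.card_pos
  have cL : ((gkBox L).card : ℝ) = Y.card * L i := by
    have := gk_box_split i L (fun _ => 1)
    simpa using this
  have cL' : ((gkBox L').card : ℝ) = Y.card * n' := by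
    have := gk_box_split i L' (fun _ => 1)
    rw [hrem, hi] at this
    simpa using this
  have hLi : (0 : ℝ) < L i := by exact_mod_cast hL i
  have hn' : (0 : ℝ) < n' := by exact_mod_cast (hL i).trans_le hn
  have e1 : gkAvg G L - gkAvg G L' = (∑ y ∈ Y,
      ((∑ t ∈ Finset.range (L i), G (i.insertNth t y)) / L i
        - (∑ t ∈ Finset.range n', G (i.insertNth t y)) / n')) / Y.card := by
    unfold gkAvg
    rw [cL, cL', gk_box_split i L, gk_box_split i L', hrem, hi, Finset.sum_sub_distrib,
      ← Finset.sum_div, ← Finset.sum_div, ← hY]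
    field_simp
  have hb : ∀ y ∈ Y, |(∑ t ∈ Finset.range (L i), G (i.insertNth t y)) / L i
        - (∑ t ∈ Finset.range n', G (i.insertNth t y)) / n'|
      ≤ 2 * ∑ t ∈ Finset.range n', C * l (i.insertNth t y) ^ α := by
    intro y _
    refine gk_avg1 (fun t => G (i.insertNth t y)) (fun t => C * l (i.insertNth t y) ^ α) _ _
      (hL i) hn (fun t => mul_nonneg hC (Real.rpow_nonneg (hl _) _)) ?_
    intro t
    have := hG (i.insertNth t y)
    simp only [Fin.insertNth_apply_same, Fin.update_insertNth] at this
    rw [← mul_add]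
    exact this
  have hbox : (gkBox L').Nonempty := by
    rw [← Finset.card_pos]
    have : (0 : ℝ) < (gkBox L').card := by rw [cL']; positivity
    exact_mod_cast this
  have hj := gk_jensen (gkBox L') l hl α ε h0 h1 (hF _) hbox
  rw [e1, abs_div, abs_of_pos hYpos, div_le_iff₀ hYpos]
  calc _ ≤ ∑ y ∈ Y, 2 * ∑ t ∈ Finset.range n', C * l (i.insertNth t y) ^ α :=
        (Finset.abs_sum_le_sum_abs _ _).trans (Finset.sum_le_sum hb)
    _ = 2 * C * ∑ x ∈ gkBox L', l x ^ α := by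
        rw [gk_box_split i L' (fun x => l x ^ α), hrem, hi]
        simp only [← Finset.mul_sum]; ring
    _ ≤ 2 * C * (((gkBox L').card : ℝ) * (((gkBox L').card : ℝ) ^ (-α) * ε ^ α)) := by
        gcongr
    _ = _ := by
        rw [show ((∏ j, L' j : ℕ) : ℝ) = (gkBox L').card by rw [gk_box_card]]
        nth_rewrite 1 [cL']
        ring

theorem gk_comb {e : ℕ} (G l : (Fin (e + 1) → ℕ) → ℝ) (hl : ∀ x, 0 ≤ l x)
    (α : Fin (e + 1) → ℝ) (ε C K τ : ℝ) (hC : 0 ≤ C) (hK : 0 ≤ K) (hτ : 0 < τ) (hτ1 : τ ≤ 1)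
    (h0 : ∀ i, 0 < α i) (hsum : ∑ i, α i = 1)
    (hF : ∀ F : Finset (Fin (e + 1) → ℕ), ∑ x ∈ F, l x ≤ ε)
    (hG : ∀ i x, |G (Function.update x i (x i + 1)) - G x|
      ≤ C * (l x ^ α i + l (Function.update x i (x i + 1)) ^ α i))
    (hGK : ∀ x, |G x| ≤ K * l x ^ τ) (s : ℕ) :
    |G 0| ≤ s * (8 * C * ∑ i, ε ^ α i) + K * (((2 : ℝ) ^ s) ^ (-τ) * ε ^ τ) := by
  have hε : 0 ≤ ε := by simpa using hF ∅
  have h1 : ∀ i, α i ≤ 1 := fun i => by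
    rw [← hsum]; exact Finset.single_le_sum (fun j _ => (h0 j).le) (Finset.mem_univ i)
  set Ls : ℕ → Fin (e + 1) → ℕ := fun s i => ⌈((2 : ℝ) ^ s) ^ α i⌉₊ with hLs
  have hlow : ∀ s i, ((2 : ℝ) ^ s) ^ α i ≤ Ls s i := fun s i => Nat.le_ceil _
  have hmono : ∀ s i, Ls s i ≤ Ls (s + 1) i := by
    intro s i
    apply Nat.ceil_mono
    apply Real.rpow_le_rpow (by positivity) _ (h0 i).le
    exact pow_le_pow_right₀ (by norm_num) (by omega)
  have hpos : ∀ s i, 0 < Ls s i := fun s i => Nat.ceil_pos.2 (by positivity)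
  have hup : ∀ s i, (Ls (s + 1) i : ℝ) ≤ 4 * ((2 : ℝ) ^ s) ^ α i := by
    intro s i
    have a1 : (Ls (s + 1) i : ℝ) < ((2 : ℝ) ^ (s + 1)) ^ α i + 1 := Nat.ceil_lt_add_one (by positivity)
    have a2 : (1 : ℝ) ≤ ((2 : ℝ) ^ s) ^ α i :=
      Real.one_le_rpow (one_le_pow₀ (by norm_num)) (h0 i).le
    have a3 : ((2 : ℝ) ^ (s + 1)) ^ α i ≤ 2 * ((2 : ℝ) ^ s) ^ α i := by
      rw [pow_succ, Real.mul_rpow (by positivity) (by norm_num), mul_comm]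
      gcongr
      calc (2 : ℝ) ^ α i ≤ 2 ^ (1 : ℝ) := Real.rpow_le_rpow_of_exponent_le (by norm_num) (h1 i)
        _ = 2 := by simp
    linarith
  have hvol : ∀ s (L : Fin (e + 1) → ℕ), (∀ i, Ls s i ≤ L i) → (2 : ℝ) ^ s ≤ ((∏ i, L i : ℕ) : ℝ) := by
    intro s L hL
    calc (2 : ℝ) ^ s = ((2 : ℝ) ^ s) ^ (∑ i, α i) := by rw [hsum]; simp
      _ = ∏ i, ((2 : ℝ) ^ s) ^ α i := by
        rw [Real.rpow_sum_of_pos (by positivity)]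
      _ ≤ ∏ i, (L i : ℝ) := by
        apply Finset.prod_le_prod (fun i _ => by positivity)
        intro i _
        exact (hlow s i).trans (by exact_mod_cast hL i)
      _ = _ := by push_cast; rfl
  have hscale : ∀ s, |gkAvg G (Ls s) - gkAvg G (Ls (s + 1))| ≤ 8 * C * ∑ i, ε ^ α i := by
    intro s
    have ind : ∀ S : Finset (Fin (e + 1)),
        |gkAvg G (Ls s) - gkAvg G (fun j => if j ∈ S then Ls (s + 1) j else Ls s j)|
          ≤ 8 * C * ∑ i ∈ S, ε ^ α i := by
      intro S
      induction S using Finset.induction_on with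
      | empty => simp
      | insert i S hi ih =>
        set L : Fin (e + 1) → ℕ := fun j => if j ∈ S then Ls (s + 1) j else Ls s j with hLdef
        have hLlow : ∀ j, Ls s j ≤ L j := by
          intro j; simp only [hLdef]; split_ifs
          · exact hmono s j
          · exact le_rfl
        have hupd : (fun j => if j ∈ insert i S then Ls (s + 1) j else Ls s j)
            = Function.update L i (Ls (s + 1) i) := by
          funext j
          by_cases hj : j = i
          · subst hj; simp
          · simp [hj, hLdef]
        have hLi : L i = Ls s i := by simp [hLdef, hi]
        have st := gk_step i L (fun j => (hpos s j).trans_le (hLlow j)) (Ls (s + 1) i)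
          (by rw [hLi]; exact hmono s i) G l hl (α i) ε C hC (h0 i) (h1 i) hF (hG i)
        rw [hupd, Finset.sum_insert hi]
        have hv := hvol s (Function.update L i (Ls (s + 1) i)) (by
          intro j
          by_cases hj : j = i
          · subst hj; simpa using hmono s j
          · simpa [hj] using hLlow j)
        have hv2 : ((∏ j, Function.update L i (Ls (s + 1) i) j : ℕ) : ℝ) ^ (-α i)
            ≤ ((2 : ℝ) ^ s) ^ (-α i) :=
          Real.rpow_le_rpow_of_nonpos (by positivity) hv (by linarith [h0 i])
        have hfin : 2 * C * (Ls (s + 1) i *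
            (((∏ j, Function.update L i (Ls (s + 1) i) j : ℕ) : ℝ) ^ (-α i) * ε ^ α i))
            ≤ 8 * C * ε ^ α i := by
          calc _ ≤ 2 * C * ((4 * ((2 : ℝ) ^ s) ^ α i) * (((2 : ℝ) ^ s) ^ (-α i) * ε ^ α i)) := by
                have := hup s i
                gcongr
            _ = 8 * C * ε ^ α i * (((2 : ℝ) ^ s) ^ α i * ((2 : ℝ) ^ s) ^ (-α i)) := by ring
            _ = _ := by
                rw [← Real.rpow_add (by positivity)]; simp
        have := abs_sub_le (gkAvg G (Ls s)) (gkAvg G L)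
          (gkAvg G (Function.update L i (Ls (s + 1) i)))
        rw [mul_add]
        linarith
    simpa using ind Finset.univ
  have hchain : ∀ s : ℕ, |gkAvg G (Ls 0) - gkAvg G (Ls s)| ≤ s * (8 * C * ∑ i, ε ^ α i) := by
    intro s
    induction s with
    | zero => simp
    | succ s ih =>
      have := abs_sub_le (gkAvg G (Ls 0)) (gkAvg G (Ls s)) (gkAvg G (Ls (s + 1)))
      have h2 := hscale s
      push_cast
      linarith
  have hstart : gkAvg G (Ls 0) = G 0 := by
    have : gkBox (Ls 0) = {0} := by
      ext x
      simp [gkBox, hLs, funext_iff]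
    simp [gkAvg, this]
  have hend : |gkAvg G (Ls s)| ≤ K * (((2 : ℝ) ^ s) ^ (-τ) * ε ^ τ) := by
    have hcard : (0 : ℝ) < (gkBox (Ls s)).card := by
      rw [gk_box_card]; exact_mod_cast Finset.prod_pos fun j _ => hpos s j
    have hne : (gkBox (Ls s)).Nonempty := by
      rw [← Finset.card_pos]; exact_mod_cast hcard
    have hj := gk_jensen (gkBox (Ls s)) l hl τ ε hτ hτ1 (hF _) hne
    unfold gkAvg
    rw [abs_div, abs_of_pos hcard, div_le_iff₀ hcard]
    calc _ ≤ ∑ x ∈ gkBox (Ls s), |G x| := Finset.abs_sum_le_sum_abs _ _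
      _ ≤ ∑ x ∈ gkBox (Ls s), K * l x ^ τ := Finset.sum_le_sum fun x _ => hGK x
      _ = K * ∑ x ∈ gkBox (Ls s), l x ^ τ := by rw [Finset.mul_sum]
      _ ≤ K * (((gkBox (Ls s)).card : ℝ) * (((gkBox (Ls s)).card : ℝ) ^ (-τ) * ε ^ τ)) := by
        gcongr
      _ ≤ K * (((gkBox (Ls s)).card : ℝ) * (((2 : ℝ) ^ s) ^ (-τ) * ε ^ τ)) := by
        have : ((gkBox (Ls s)).card : ℝ) ^ (-τ) ≤ ((2 : ℝ) ^ s) ^ (-τ) := by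
          apply Real.rpow_le_rpow_of_nonpos (by positivity) _ (by linarith)
          rw [gk_box_card]; exact hvol s _ fun i => le_rfl
        gcongr
      _ = _ := by ring
  have h3 := hchain s
  rw [hstart] at h3
  have := abs_sub_abs_le_abs_sub (G 0) (gkAvg G (Ls s))
  linarith

theorem gk_len {ι : Type*} (F : Finset ι) (A B : ι → ℝ) (hAB : ∀ i, A i ≤ B i)
    (hA : ∀ i, 0 ≤ A i) (hB : ∀ i, B i ≤ 1)
    (hd : ∀ i j, i ≠ j → B i ≤ A j ∨ B j ≤ A i) :
    ∑ i ∈ F, (B i - A i) ≤ 1 := by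
  have hdis : Set.PairwiseDisjoint (F : Set ι) (fun i => Set.Ioo (A i) (B i)) := by
    intro i _ j _ hij
    rw [Function.onFun, Set.disjoint_left]
    rintro x ⟨h1, h2⟩ ⟨h3, h4⟩
    rcases hd i j hij with h | h <;> linarith
  have h1 := MeasureTheory.measure_biUnion_finset (μ := MeasureTheory.volume) hdis
    (fun i _ => measurableSet_Ioo)
  have h2 : MeasureTheory.volume (⋃ i ∈ F, Set.Ioo (A i) (B i)) ≤
      MeasureTheory.volume (Set.Icc (0 : ℝ) 1) := by
    apply MeasureTheory.measure_mono
    intro x hx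
    simp only [Set.mem_iUnion] at hx
    obtain ⟨i, _, h3, h4⟩ := hx
    exact ⟨by linarith [hA i], by linarith [hB i]⟩
  rw [h1] at h2
  simp only [Real.volume_Ioo, Real.volume_Icc] at h2
  rw [← ENNReal.ofReal_sum_of_nonneg (fun i _ => sub_nonneg.2 (hAB i))] at h2
  have := (ENNReal.ofReal_le_ofReal_iff (by norm_num)).1 h2
  linarith

theorem gk_seq (t : ℕ → ℝ) (h0 : ∀ n, 0 < t n) (hs : ∀ N, ∑ n ∈ Finset.range N, t n ≤ 1) :
    ∃ n, t (n + 1) ≤ t n := by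
  by_contra! h
  have hm : StrictMono t := strictMono_nat_of_lt_succ h
  obtain ⟨N, hN⟩ := exists_nat_gt (1 / t 0)
  have : ∑ n ∈ Finset.range N, t 0 ≤ ∑ n ∈ Finset.range N, t n :=
    Finset.sum_le_sum fun n _ => hm.monotone (Nat.zero_le n)
  rw [div_lt_iff₀ (h0 0)] at hN
  simp at this
  linarith [hs N]

theorem gk_log (r r' : ℝ) (h : 1 / 2 ≤ r) (h' : 1 / 2 ≤ r') :
    |Real.log r - Real.log r'| ≤ 2 * |r - r'| := by
  have key : ∀ x y : ℝ, 1 / 2 ≤ x → 1 / 2 ≤ y → Real.log x - Real.log y ≤ 2 * |x - y| := by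
    intro x y hx hy
    rw [← Real.log_div (by linarith) (by linarith)]
    have := Real.log_le_sub_one_of_pos (show 0 < x / y by apply div_pos <;> linarith)
    have h2 : x / y - 1 = (x - y) / y := by field_simp
    have h3 : (x - y) / y ≤ 2 * |x - y| := by
      rw [div_le_iff₀ (by linarith)]
      have := le_abs_self (x - y)
      nlinarith [abs_nonneg (x - y)]
    linarith
  rw [abs_le]
  constructor
  · have := key r' r h' h
    rw [abs_sub_comm] at this
    linarith
  · exact key r r' h h'

theorem gk_lex {n : ℕ} (u v : Fin n → ℤ) (h : u ≠ v) :
    (∃ k, (∀ m, m < k → u m = v m) ∧ u k < v k) ∨ (∃ k, (∀ m, m < k → v m = u m) ∧ v k < u k) := by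
  classical
  have hex : ∃ k, u k ≠ v k := Function.ne_iff.1 h
  let S := Finset.univ.filter (fun k => u k ≠ v k)
  have hS : S.Nonempty := by
    obtain ⟨k, hk⟩ := hex
    exact ⟨k, by simp [S, hk]⟩
  have hk := Finset.min'_mem S hS
  set k := S.min' hS
  have hlt : ∀ m, m < k → u m = v m := by
    intro m hm
    by_contra hne
    have : k ≤ m := Finset.min'_le S m (by simp [S, hne])
    exact absurd hm (not_lt.2 this)
  simp [S] at hk
  rcases lt_or_gt_of_ne hk with h1 | h1
  · exact Or.inl ⟨k, hlt, h1⟩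
  · exact Or.inr ⟨k, fun m hm => (hlt m hm).symm, h1⟩

/-- shifting a multi-index by one in direction `j` -/
def gkS {n : ℕ} (j : Fin n) (u : Fin n → ℤ) : Fin n → ℤ := Function.update u j (u j + 1)

def gkU {n : ℕ} (v : Fin n → ℤ) (m : ℤ) : Fin (n + 1) → ℤ := Fin.snoc (α := fun _ => ℤ) v m

theorem gkU_upd {n : ℕ} (v : Fin n → ℤ) (m k : ℤ) :
    Function.update (gkU v m) (Fin.last n) k = gkU v k := by
  funext r
  induction r using Fin.lastCases with
  | last => simp [gkU]
  | cast r => simp [gkU]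

theorem gkU_last {n : ℕ} (v : Fin n → ℤ) (m : ℤ) : gkS (Fin.last n) (gkU v m) = gkU v (m + 1) := by
  rw [gkS, gkU_upd]; simp [gkU]

theorem gkU_zero {n : ℕ} (v : Fin (n + 1) → ℤ) (m : ℤ) : gkU v m 0 = v 0 := by
  have := Fin.snoc_castSucc (α := fun _ => ℤ) m v 0
  simpa [gkU] using this

theorem gkU_cast {n : ℕ} (i : Fin n) (v : Fin n → ℤ) (m : ℤ) :
    gkS i.castSucc (gkU v m) = gkU (gkS i v) m := by
  simp [gkS, gkU]

theorem gkU_lex {n : ℕ} (u v : Fin n → ℤ) (m m' : ℤ)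
    (h : ∃ k, (∀ r, r < k → u r = v r) ∧ u k < v k) :
    ∃ k, (∀ r, r < k → gkU u m r = gkU v m' r) ∧ gkU u m k < gkU v m' k := by
  obtain ⟨k, h1, h2⟩ := h
  refine ⟨k.castSucc, ?_, by simpa [gkU] using h2⟩
  intro r hr
  induction r using Fin.lastCases with
  | last => exact absurd hr (not_lt.2 (Fin.le_last _))
  | cast r => simpa [gkU] using h1 r (by simpa using hr)

def gkσ {e : ℕ} (n0 : ℤ) (x : Fin (e + 1) → ℕ) : Fin (e + 1) → ℤ :=
  fun i => if i = 0 then -n0 - x i else x i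

theorem gkσ_zero {e : ℕ} (n0 : ℤ) (x : Fin (e + 1) → ℕ) :
    gkS 0 (gkσ n0 (Function.update x 0 (x 0 + 1))) = gkσ n0 x := by
  funext i
  by_cases h : i = 0
  · subst h; simp [gkS, gkσ]; ring
  · simp [gkS, gkσ, h]

theorem gkσ_pos {e : ℕ} (n0 : ℤ) (x : Fin (e + 1) → ℕ) (j : Fin (e + 1)) (hj : j ≠ 0) :
    gkS j (gkσ n0 x) = gkσ n0 (Function.update x j (x j + 1)) := by
  funext i
  by_cases h : i = j
  · subst h; simp [gkS, gkσ, hj]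
  · simp [gkS, gkσ, h]

theorem gkσ_inj {e : ℕ} (n0 : ℤ) : Function.Injective (gkσ (e := e) n0) := by
  intro x y h
  funext i
  have := congrFun h i
  simp only [gkσ] at this
  split_ifs at this <;> omega

theorem gk_core (e : ℕ) (a b : (Fin (e + 2) → ℤ) → ℝ) (hab : ∀ u, a u < b u)
    (ha0 : ∀ u, 0 ≤ a u) (hb1 : ∀ u, b u ≤ 1)
    (hlex : ∀ u v : Fin (e + 2) → ℤ,
      (∃ k, (∀ m, m < k → u m = v m) ∧ u k < v k) → b u < a v)
    (β : Fin (e + 2) → ℝ) (hβ0 : ∀ j, 0 < β j) (hsum : ∑ i : Fin (e + 1), β i.castSucc = 1)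
    (hβ1 : β (Fin.last (e + 1)) ≤ 1) (C : ℝ) (hC : 0 ≤ C)
    (hR : ∀ j u v D s, s ≤ a u → b u ≤ s + D → s ≤ a v → b v ≤ s + D →
      |(b (gkS j u) - a (gkS j u)) / (b u - a u) - (b (gkS j v) - a (gkS j v)) / (b v - a v)|
        ≤ C * D ^ β j) : False := by
  set lam : (Fin (e + 2) → ℤ) → ℝ := fun u => b u - a u with hlam
  have lam0 : ∀ u, 0 < lam u := fun u => sub_pos.2 (hab u)
  set R : Fin (e + 2) → (Fin (e + 2) → ℤ) → ℝ := fun j u => lam (gkS j u) / lam u with hRdef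
  replace hR : ∀ j u v D s, s ≤ a u → b u ≤ s + D → s ≤ a v → b v ≤ s + D →
      |R j u - R j v| ≤ C * D ^ β j := hR
  have hdisj : ∀ u v, u ≠ v → b u ≤ a v ∨ b v ≤ a u := by
    intro u v h
    rcases gk_lex u v h with h | h
    · exact Or.inl (hlex _ _ h).le
    · exact Or.inr (hlex _ _ h).le
  have hseq : ∀ t : ℕ → (Fin (e + 2) → ℤ), Function.Injective t → ∀ N,
      ∑ n ∈ Finset.range N, lam (t n) ≤ 1 := by
    intro t ht N
    exact gk_len (Finset.range N) (fun n => a (t n)) (fun n => b (t n)) (fun n => (hab _).le)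
      (fun n => ha0 _) (fun n => hb1 _) (fun i j hij => hdisj _ _ (ht.ne hij))
  have hge : ∀ j u, ∃ n : ℕ, 1 ≤ R j (Function.update u j (u j - n)) := by
    intro j u
    obtain ⟨n, hn⟩ := gk_seq (fun n => lam (Function.update u j (u j - n))) (fun n => lam0 _)
      (hseq _ (by
        intro x y h
        have := congrFun h j
        simpa using this))
    refine ⟨n + 1, ?_⟩
    have e1 : gkS j (Function.update u j (u j - ((n + 1 : ℕ) : ℤ))) = Function.update u j (u j - n) := by
      simp [gkS]; ring_nf
    simp only [hRdef]
    rw [e1, le_div_iff₀ (lam0 _), one_mul]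
    exact hn
  have hle : ∀ j u, ∃ n : ℕ, R j (Function.update u j (u j + n)) ≤ 1 := by
    intro j u
    obtain ⟨n, hn⟩ := gk_seq (fun n => lam (Function.update u j (u j + n))) (fun n => lam0 _)
      (hseq _ (by
        intro x y h
        have := congrFun h j
        simpa using this))
    refine ⟨n, ?_⟩
    have e1 : gkS j (Function.update u j (u j + n))
        = Function.update u j (u j + ((n + 1 : ℕ) : ℤ)) := by
      simp [gkS]; ring_nf
    simp only [hRdef]
    rw [e1, div_le_iff₀ (lam0 _), one_mul]
    exact hn
  -- hulls
  set p : (Fin (e + 1) → ℤ) → ℝ := fun v => ⨅ m, a (gkU v m) with hp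
  set q : (Fin (e + 1) → ℤ) → ℝ := fun v => ⨆ m, b (gkU v m) with hq
  have hpa : ∀ v m, p v ≤ a (gkU v m) := fun v m =>
    ciInf_le ⟨0, by rintro _ ⟨m, rfl⟩; exact ha0 _⟩ m
  have hqb : ∀ v m, b (gkU v m) ≤ q v := fun v m =>
    le_ciSup (f := fun m => b (gkU v m)) ⟨1, by rintro _ ⟨m, rfl⟩; exact hb1 _⟩ m
  have hp0 : ∀ v, 0 ≤ p v := fun v => le_ciInf fun m => ha0 _
  have hq1 : ∀ v, q v ≤ 1 := fun v => ciSup_le fun m => hb1 _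
  have hpq : ∀ v, p v ≤ q v := fun v => (hpa v 0).trans ((hab _).le.trans (hqb v 0))
  set l : (Fin (e + 1) → ℤ) → ℝ := fun v => q v - p v with hl
  have hl0 : ∀ v, 0 ≤ l v := fun v => sub_nonneg.2 (hpq v)
  have hpqd : ∀ u v, u ≠ v → q u ≤ p v ∨ q v ≤ p u := by
    have aux : ∀ u v : Fin (e + 1) → ℤ, (∃ k, (∀ m, m < k → u m = v m) ∧ u k < v k) → q u ≤ p v :=
      fun u v h => ciSup_le fun m => le_ciInf fun m' => (hlex _ _ (gkU_lex u v m m' h)).le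
    intro u v h
    rcases gk_lex u v h with h | h
    · exact Or.inl (aux _ _ h)
    · exact Or.inr (aux _ _ h)
  have hlsum : ∀ F : Finset (Fin (e + 1) → ℤ), ∑ v ∈ F, l v ≤ 1 := fun F =>
    gk_len F p q hpq hp0 hq1 hpqd
  have hlsummable : Summable l := summable_of_sum_le hl0 hlsum
  have hRl : ∀ j v m m', |R j (gkU v m) - R j (gkU v m')| ≤ C * l v ^ β j := by
    intro j v m m'
    apply hR j _ _ (l v) (p v) (hpa _ _) _ (hpa _ _)
    · simpa [hl] using hqb v m'
    · simpa [hl] using hqb v m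
  set τ := β (Fin.last (e + 1)) with hτ
  have hτ0 : 0 < τ := hβ0 _
  have hRlast : ∀ v m, |R (Fin.last _) (gkU v m) - 1| ≤ C * l v ^ τ := by
    intro v m
    obtain ⟨n, hn⟩ := hge (Fin.last _) (gkU v 0)
    obtain ⟨n', hn'⟩ := hle (Fin.last _) (gkU v 0)
    rw [gkU_upd] at hn hn'
    have h1 := abs_le.1 (hRl (Fin.last _) v m _ : |_ - R _ (gkU v (gkU v 0 (Fin.last _) - n))| ≤ _)
    have h2 := abs_le.1 (hRl (Fin.last _) v m _ : |_ - R _ (gkU v (gkU v 0 (Fin.last _) + n'))| ≤ _)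
    rw [abs_le]
    constructor <;> linarith [h1.1, h1.2, h2.1, h2.2]
  -- choice of small parameters
  have hcont : ∀ j, Filter.Tendsto (fun x : ℝ => x ^ β j) (nhdsWithin 0 (Set.Ioi 0)) (nhds 0) := by
    intro j
    have := (Real.continuousAt_rpow_const 0 (β j) (Or.inr (hβ0 j).le)).tendsto
    rw [Real.zero_rpow (hβ0 j).ne'] at this
    exact this.mono_left nhdsWithin_le_nhds
  have hlog2 : 0 < Real.log 2 := Real.log_pos (by norm_num)
  obtain ⟨ε, hε0, hε1, hεc⟩ : ∃ ε : ℝ, 0 < ε ∧ ε ≤ 1 ∧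
      8 * (2 * C) * ∑ i : Fin (e + 1), ε ^ β i.castSucc ≤ τ / 2 * Real.log 2 := by
    have h1 : Filter.Tendsto (fun x : ℝ => 8 * (2 * C) * ∑ i : Fin (e + 1), x ^ β i.castSucc)
        (nhdsWithin 0 (Set.Ioi 0)) (nhds (8 * (2 * C) * ∑ i : Fin (e + 1), 0)) :=
      (tendsto_finsetSum _ fun i _ => hcont _).const_mul _
    have h2 := h1.eventually_lt_const (u := τ / 2 * Real.log 2) (by simp; positivity)
    have h3 : ∀ᶠ x : ℝ in nhdsWithin 0 (Set.Ioi 0), x ∈ Set.Ioo (0 : ℝ) 1 :=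
      Ioo_mem_nhdsGT (by norm_num)
    obtain ⟨x, hx, hx'⟩ := (h2.and h3).exists
    exact ⟨x, hx'.1, hx'.2.le, hx.le⟩
  obtain ⟨η, hη0, hη⟩ : ∃ η : ℝ, 0 < η ∧ ∀ j, C * η ^ β j ≤ 1 / 2 := by
    have h1 : ∀ᶠ x : ℝ in nhdsWithin 0 (Set.Ioi 0), ∀ j, C * x ^ β j < 1 / 2 := by
      rw [Filter.eventually_all]
      intro j
      exact ((hcont j).const_mul C).eventually_lt_const (by norm_num)
    obtain ⟨x, hx, hx'⟩ := (h1.and self_mem_nhdsWithin).exists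
    exact ⟨x, hx', fun j => (hx j).le⟩
  set P := ⨅ u, a u with hP
  have hPa : ∀ u, P ≤ a u := fun u => ciInf_le ⟨0, by rintro _ ⟨m, rfl⟩; exact ha0 _⟩ u
  obtain ⟨v0, hv0⟩ : ∃ v, a v < P + η := exists_lt_of_ciInf_lt (by linarith)
  obtain ⟨F, hFsm⟩ := summable_iff_vanishing_norm.1 hlsummable ε hε0
  obtain ⟨M, hM⟩ := (insert (v0 0) (F.image fun u => u 0)).bddBelow
  set n0 : ℤ := 1 - M with hn0
  have hn0v : -n0 < v0 0 := by have := hM (show v0 0 ∈ _ by simp); omega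
  have hn0F : ∀ u ∈ F, -n0 < u 0 := by
    intro u hu
    have := hM (Finset.mem_coe.2 (Finset.mem_insert_of_mem (Finset.mem_image_of_mem (fun u => u 0) hu))); omega
  have hhalf : ∀ j u, u 0 ≤ -n0 → 1 / 2 ≤ R j u := by
    intro j u hu
    obtain ⟨n, hn⟩ := hge j u
    have hb : ∀ w : Fin (e + 2) → ℤ, w 0 ≤ -n0 → b w ≤ P + η := by
      intro w hw
      have := hlex w v0 ⟨0, fun m hm => absurd hm (Fin.not_lt_zero m), by omega⟩
      linarith
    have h2 := hR j u (Function.update u j (u j - n)) η P (hPa _) (hb _ hu) (hPa _) (hb _ (by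
      by_cases h : j = 0
      · subst h; simp; omega
      · rw [Function.update_of_ne (Ne.symm h)]; exact hu))
    have h3 := (abs_le.1 h2).1
    linarith [hη j]
  -- the potential
  set Gv : ℕ → (Fin (e + 1) → ℤ) → ℝ := fun k v =>
    Real.log (lam (gkU v k) / lam (gkU v 0)) with hGv
  have hGlog : ∀ k v, Gv k v = Real.log (lam (gkU v k)) - Real.log (lam (gkU v 0)) :=
    fun k v => Real.log_div (lam0 _).ne' (lam0 _).ne'
  have hRlog : ∀ j u, Real.log (R j u) = Real.log (lam (gkS j u)) - Real.log (lam u) :=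
    fun j u => Real.log_div (lam0 _).ne' (lam0 _).ne'
  have hstep : ∀ k i v, v 0 ≤ -n0 → |Gv k (gkS i v) - Gv k v| ≤ 2 * C * l v ^ β i.castSucc := by
    intro k i v hv
    have h1 := gk_log (R i.castSucc (gkU v k)) (R i.castSucc (gkU v 0))
      (hhalf _ _ (by rwa [gkU_zero])) (hhalf _ _ (by rwa [gkU_zero]))
    have h2 := hRl i.castSucc v k 0
    rw [hRlog, hRlog, gkU_cast, gkU_cast] at h1
    rw [hGlog, hGlog]
    have e1 : Real.log (lam (gkU (gkS i v) k)) - Real.log (lam (gkU (gkS i v) 0)) -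
        (Real.log (lam (gkU v k)) - Real.log (lam (gkU v 0))) =
        Real.log (lam (gkU (gkS i v) k)) - Real.log (lam (gkU v k)) -
        (Real.log (lam (gkU (gkS i v) 0)) - Real.log (lam (gkU v 0))) := by ring
    rw [e1]
    linarith
  have hsmall : ∀ k v, v 0 ≤ -n0 → |Gv k v| ≤ 2 * C * k * l v ^ τ := by
    intro k v hv
    induction k with
    | zero => simp [hGlog]
    | succ k ih =>
      have h1 := gk_log (R (Fin.last _) (gkU v k)) 1 (hhalf _ _ (by rwa [gkU_zero])) (by norm_num)
      have h2 := hRlast v k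
      rw [hRlog, gkU_last] at h1
      simp only [Real.log_one, sub_zero] at h1
      have e1 : Gv (k + 1) v = Gv k v +
          (Real.log (lam (gkU v (k + 1))) - Real.log (lam (gkU v k))) := by
        rw [hGlog, hGlog]; push_cast; ring
      rw [e1]
      have := abs_add_le (Gv k v) (Real.log (lam (gkU v (k + 1))) - Real.log (lam (gkU v k)))
      push_cast
      linarith
  have hσ0 : ∀ x : Fin (e + 1) → ℕ, gkσ n0 x 0 ≤ -n0 := by
    intro x; simp [gkσ]
  have hmain : ∀ k s : ℕ, |Gv k (gkσ n0 0)| ≤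
      s * (8 * (2 * C) * ∑ i : Fin (e + 1), ε ^ β i.castSucc)
        + 2 * C * k * (((2 : ℝ) ^ s) ^ (-τ) * ε ^ τ) := by
    intro k s
    refine gk_comb (fun x => Gv k (gkσ n0 x)) (fun x => l (gkσ n0 x)) (fun x => hl0 _)
      (fun i => β i.castSucc) ε (2 * C) (2 * C * k) τ (by positivity) (by positivity) hτ0 hβ1
      (fun i => hβ0 _) hsum ?_ ?_ (fun x => hsmall k _ (hσ0 x)) s
    · intro T
      have h1 := hFsm (T.image (gkσ n0)) (by
        rw [Finset.disjoint_left]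
        intro u hu huF
        obtain ⟨x, _, rfl⟩ := Finset.mem_image.1 hu
        exact absurd (hn0F _ huF) (not_lt.2 (hσ0 x)))
      rw [Finset.sum_image (fun x _ y _ h => gkσ_inj n0 h)] at h1
      exact (le_abs_self _).trans h1.le
    · intro i x
      have hA : 0 ≤ l (gkσ n0 x) ^ β i.castSucc := Real.rpow_nonneg (hl0 _) _
      have hB : 0 ≤ l (gkσ n0 (Function.update x i (x i + 1))) ^ β i.castSucc :=
        Real.rpow_nonneg (hl0 _) _
      by_cases h : i = 0
      · subst h
        have := hstep k 0 (gkσ n0 (Function.update x 0 (x 0 + 1))) (hσ0 _)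
        rw [gkσ_zero, abs_sub_comm] at this
        refine this.trans ?_
        gcongr
        linarith
      · have := hstep k i (gkσ n0 x) (hσ0 _)
        rw [gkσ_pos _ _ _ h] at this
        refine this.trans ?_
        gcongr
        linarith
  -- lower bounds on lengths
  set w0 := gkσ (e := e) n0 0 with hw0
  set c0 := lam (gkU w0 0) * Real.exp (-(2 * C)) with hc0
  have hc0pos : 0 < c0 := mul_pos (lam0 _) (Real.exp_pos _)
  set A : ℝ := Real.exp (τ / 2 * Real.log 2) with hA
  have hA1 : 1 < A := by rw [hA, Real.one_lt_exp_iff]; positivity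
  have hAs : ∀ s : ℕ, ((2 : ℝ) ^ s) ^ τ = A ^ s * A ^ s := by
    intro s
    rw [hA, ← Real.exp_nat_mul, ← Real.exp_add, Real.rpow_def_of_pos (by positivity), Real.log_pow]
    congr 1; ring
  have hlow : ∀ s k : ℕ, (k : ℝ) ≤ A ^ s * A ^ s → c0 / A ^ s ≤ lam (gkU w0 k) := by
    intro s k hk
    have h1 := hmain k s
    have h2 : 2 * C * k * (((2 : ℝ) ^ s) ^ (-τ) * ε ^ τ) ≤ 2 * C := by
      rw [Real.rpow_neg (by positivity), hAs]
      have h3 : ε ^ τ ≤ 1 := Real.rpow_le_one hε0.le hε1 hτ0.le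
      have hAA : 0 < A ^ s * A ^ s := by positivity
      have h4 : (k : ℝ) * ((A ^ s * A ^ s)⁻¹ * ε ^ τ) ≤ 1 := by
        calc (k : ℝ) * ((A ^ s * A ^ s)⁻¹ * ε ^ τ)
            ≤ (A ^ s * A ^ s) * ((A ^ s * A ^ s)⁻¹ * 1) := by gcongr
          _ = 1 := by field_simp
      nlinarith
    have h5 : (s : ℝ) * (8 * (2 * C) * ∑ i : Fin (e + 1), ε ^ β i.castSucc)
        ≤ s * (τ / 2 * Real.log 2) := by gcongr
    have h6 : -(s * (τ / 2 * Real.log 2)) - 2 * C ≤ Gv k w0 := by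
      have := (abs_le.1 h1).1
      linarith
    have h7 : lam (gkU w0 k) = lam (gkU w0 0) * Real.exp (Gv k w0) := by
      rw [hGv]
      simp only
      rw [Real.exp_log (div_pos (lam0 _) (lam0 _))]
      have := (lam0 (gkU w0 0)).ne'
      field_simp
    rw [h7]
    have h8 : c0 / A ^ s = lam (gkU w0 0) * Real.exp (-(s * (τ / 2 * Real.log 2)) - 2 * C) := by
      rw [hc0, hA, ← Real.exp_nat_mul, div_eq_mul_inv, ← Real.exp_neg, mul_assoc,
        ← Real.exp_add]
      congr 2; ring
    rw [h8]
    gcongr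
    exact (lam0 _).le
  obtain ⟨s, hs⟩ := pow_unbounded_of_one_lt (1 / c0) hA1
  have h1 := hseq (fun n => gkU w0 n) (by
    intro x y h
    have := congrFun h (Fin.last _)
    simpa [gkU] using this) ⌈A ^ s * A ^ s⌉₊
  have h2 : ∑ n ∈ Finset.range ⌈A ^ s * A ^ s⌉₊, c0 / A ^ s ≤
      ∑ n ∈ Finset.range ⌈A ^ s * A ^ s⌉₊, lam (gkU w0 n) := by
    refine Finset.sum_le_sum fun n hn => hlow s n ?_
    rw [Finset.mem_range, Nat.lt_ceil] at hn
    exact hn.le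
  simp only [Finset.sum_const, Finset.card_range, nsmul_eq_mul] at h2
  have hApos : 0 < A ^ s := by positivity
  have h3 : A ^ s * c0 ≤ (⌈A ^ s * A ^ s⌉₊ : ℝ) * (c0 / A ^ s) := by
    calc A ^ s * c0 = (A ^ s * A ^ s) * (c0 / A ^ s) := by field_simp
      _ ≤ _ := by
        have := Nat.le_ceil (A ^ s * A ^ s)
        gcongr
  rw [div_lt_iff₀ hc0pos] at hs
  linarith



/-- **Generalized Kopell Lemma in critical but different regularities (Theorem B).**
In the setting of Theorem A, if each `f i` (for `i < d`) is of class `C^{1+α_i}` with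
`0 < α_i ≤ 1`, and `f (Fin.last d)` is of class `C^{1+α_{d+1}}` for some exponent
`α_{d+1} > 0` and commutes with the other maps, then `α_1 + ⋯ + α_d < 1`. -/
theorem generalized_kopell_different_regularities
    (d : ℕ) (hd : 1 ≤ d)
    (a b : (Fin (d + 1) → ℤ) → ℝ)
    (hab : ∀ u, a u < b u)
    (hsub : ∀ u, Set.Icc (a u) (b u) ⊆ Set.Icc (0 : ℝ) 1)
    (hlex : ∀ u v : Fin (d + 1) → ℤ,
      (∃ k, (∀ m, m < k → u m = v m) ∧ u k < v k) → b u < a v)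
    (f : Fin (d + 1) → ℝ → ℝ)
    (hbij : ∀ j, Set.BijOn (f j) (Set.Icc (0 : ℝ) 1) (Set.Icc (0 : ℝ) 1))
    (hC1 : ∀ j, ContDiffOn ℝ 1 (f j) (Set.Icc (0 : ℝ) 1))
    (hmap : ∀ (j : Fin (d + 1)) (u : Fin (d + 1) → ℤ),
      f j '' Set.Icc (a u) (b u)
        = Set.Icc (a (Function.update u j (u j + 1))) (b (Function.update u j (u j + 1))))
    (α : Fin (d + 1) → ℝ)
    (hα : ∀ i : Fin d, 0 < α i.castSucc ∧ α i.castSucc ≤ 1)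
    (hαlast : 0 < α (Fin.last d))
    (hHolder : ∀ j : Fin (d + 1), ∃ C : ℝ, ∀ x ∈ Set.Icc (0 : ℝ) 1, ∀ y ∈ Set.Icc (0 : ℝ) 1,
      |derivWithin (f j) (Set.Icc (0 : ℝ) 1) x - derivWithin (f j) (Set.Icc (0 : ℝ) 1) y|
        ≤ C * |x - y| ^ (α j))
    (hcomm : ∀ i : Fin d, ∀ x ∈ Set.Icc (0 : ℝ) 1,
      f (Fin.last d) (f i.castSucc x) = f i.castSucc (f (Fin.last d) x)) :
    (∑ i : Fin d, α i.castSucc) < 1 := by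
  by_contra! hcon
  obtain ⟨e, rfl⟩ : ∃ e, d = e + 1 := ⟨d - 1, by omega⟩
  have hne : ∀ u, (a u ∈ Set.Icc (0 : ℝ) 1) ∧ b u ∈ Set.Icc (0 : ℝ) 1 := fun u =>
    ⟨hsub u ⟨le_rfl, (hab u).le⟩, hsub u ⟨(hab u).le, le_rfl⟩⟩
  -- monotonicity
  have hmonoj : ∀ j, StrictMonoOn (f j) (Set.Icc (0 : ℝ) 1) := by
    intro j
    rcases (hC1 j).continuousOn.strictMonoOn_of_injOn_Icc' zero_le_one (hbij j).injOn with h | h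
    · exact h
    · exfalso
      set u : Fin (e + 1 + 1) → ℤ := 0 with hu
      set v : Fin (e + 1 + 1) → ℤ := Function.update u j 1 with hv
      have huv : b u < a v := hlex u v ⟨j, fun m hm => by simp [hv, hm.ne], by simp [hv, hu]⟩
      have h1 : f j (a u) ∈ f j '' Set.Icc (a u) (b u) := ⟨a u, ⟨le_rfl, (hab u).le⟩, rfl⟩
      have h2 : f j (a v) ∈ f j '' Set.Icc (a v) (b v) := ⟨a v, ⟨le_rfl, (hab v).le⟩, rfl⟩
      rw [hmap j u] at h1
      rw [hmap j v] at h2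
      have h3 := h (hne u).1 (hne v).1 ((hab u).trans huv)
      have h4 := hlex (Function.update u j (u j + 1)) (Function.update v j (v j + 1))
        ⟨j, fun m hm => by simp [hv, hm.ne], by simp [hv, hu]⟩
      linarith [h1.2, h2.1]
  have hslope : ∀ j u, ∃ ξ ∈ Set.Icc (a u) (b u),
      derivWithin (f j) (Set.Icc (0 : ℝ) 1) ξ
        = (b (gkS j u) - a (gkS j u)) / (b u - a u) := by
    intro j u
    have hm := hmap j u
    have hfa : f j (a u) = a (gkS j u) := by
      apply le_antisymm
      · have : a (gkS j u) ∈ f j '' Set.Icc (a u) (b u) := by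
          rw [hm]; exact ⟨le_rfl, (hab (gkS j u)).le⟩
        obtain ⟨x, hx, hxe⟩ := this
        rw [← hxe]
        exact (hmonoj j).monotoneOn (hne u).1 (hsub u hx) hx.1
      · have : f j (a u) ∈ f j '' Set.Icc (a u) (b u) := ⟨a u, ⟨le_rfl, (hab u).le⟩, rfl⟩
        rw [hm] at this
        exact this.1
    have hfb : f j (b u) = b (gkS j u) := by
      apply le_antisymm
      · have : f j (b u) ∈ f j '' Set.Icc (a u) (b u) := ⟨b u, ⟨(hab u).le, le_rfl⟩, rfl⟩
        rw [hm] at this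
        exact this.2
      · have : b (gkS j u) ∈ f j '' Set.Icc (a u) (b u) := by
          rw [hm]; exact ⟨(hab (gkS j u)).le, le_rfl⟩
        obtain ⟨x, hx, hxe⟩ := this
        rw [← hxe]
        exact (hmonoj j).monotoneOn (hsub u hx) (hne u).2 hx.2
    have hnh : ∀ x ∈ Set.Ioo (a u) (b u), Set.Icc (0 : ℝ) 1 ∈ nhds x := fun x hx =>
      Icc_mem_nhds (lt_of_le_of_lt (hne u).1.1 hx.1) (lt_of_lt_of_le hx.2 (hne u).2.2)
    obtain ⟨c, hc, hce⟩ := exists_deriv_eq_slope (f j) (hab u)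
      ((hC1 j).continuousOn.mono (hsub u))
      (fun x hx => (((hC1 j).differentiableOn (by norm_num) x
        (hsub u ⟨hx.1.le, hx.2.le⟩)).differentiableAt (hnh x hx)).differentiableWithinAt)
    refine ⟨c, ⟨hc.1.le, hc.2.le⟩, ?_⟩
    rw [derivWithin_of_mem_nhds (hnh c hc), hce, hfa, hfb]
  -- normalised exponents
  set σ := ∑ i : Fin (e + 1), α i.castSucc with hσ
  have hσpos : 0 < σ := by linarith
  set β : Fin (e + 1 + 1) → ℝ :=
    Fin.snoc (α := fun _ => ℝ) (fun i : Fin (e + 1) => α i.castSucc / σ)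
      (min (α (Fin.last _)) 1) with hβ
  have hβc : ∀ i : Fin (e + 1), β i.castSucc = α i.castSucc / σ := fun i => by simp [hβ]
  have hβl : β (Fin.last _) = min (α (Fin.last _)) 1 := by simp [hβ]
  have hβ0 : ∀ j, 0 < β j := by
    intro j
    induction j using Fin.lastCases with
    | last => rw [hβl]; exact lt_min hαlast one_pos
    | cast i => rw [hβc]; exact div_pos (hα i).1 hσpos
  have hβα : ∀ j, β j ≤ α j := by
    intro j
    induction j using Fin.lastCases with
    | last => rw [hβl]; exact min_le_left _ _
    | cast i => rw [hβc]; exact div_le_self (hα i).1.le hcon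
  choose Cj hCj using hHolder
  refine gk_core e a b hab (fun u => (hne u).1.1) (fun u => (hne u).2.2) hlex β hβ0 ?_ ?_
    (∑ j, |Cj j|) (Finset.sum_nonneg fun j _ => abs_nonneg _) ?_
  · simp only [hβc]
    rw [← Finset.sum_div, ← hσ, div_self hσpos.ne']
  · rw [hβl]; exact min_le_right _ _
  · intro j u v D s h1 h2 h3 h4
    obtain ⟨ξ, hξ, hξe⟩ := hslope j u
    obtain ⟨ζ, hζ, hζe⟩ := hslope j v
    rw [← hξe, ← hζe]
    have hξ' := hsub u hξ
    have hζ' := hsub v hζ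
    refine (hCj j ξ hξ' ζ hζ').trans ?_
    have hd1 : |ξ - ζ| ≤ 1 := by
      rw [abs_le]; constructor <;> linarith [hξ'.1, hξ'.2, hζ'.1, hζ'.2]
    have hdD : |ξ - ζ| ≤ D := by
      rw [abs_le]; constructor <;> linarith [hξ.1, hξ.2, hζ.1, hζ.2]
    have hpow : |ξ - ζ| ^ α j ≤ D ^ β j := by
      refine le_trans ?_ (Real.rpow_le_rpow (abs_nonneg _) hdD (hβ0 j).le)
      rcases (abs_nonneg (ξ - ζ)).eq_or_lt with h | h
      · rw [← h, Real.zero_rpow (hβ0 j).ne', Real.zero_rpow ((hβ0 j).trans_le (hβα j)).ne']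
      · exact Real.rpow_le_rpow_of_exponent_ge h hd1 (hβα j)
    have hCle : Cj j ≤ ∑ j, |Cj j| := (le_abs_self _).trans
      (Finset.single_le_sum (f := fun j => |Cj j|) (fun j _ => abs_nonneg _) (Finset.mem_univ j))
    have hS : 0 ≤ ∑ j, |Cj j| := Finset.sum_nonneg fun j _ => abs_nonneg _
    exact mul_le_mul hCle hpow (Real.rpow_nonneg (abs_nonneg _) _) hS
end

section
/- Let d ≥ 1 and let ℓ : ℕ_0^d → (0,∞) be a function with Σ_{v ∈ ℕ_0^d} ℓ(v) < ∞. Then there exists a constant B > 0 such that for each n ∈ ℕ there is a geodesic path p_0, p_1, …, p_n in ℕ_0^d (meaning p_0 = (0,…,0) and each difference p_{j+1} − p_j is a standard basis vector) satisfying both Σ_{j=0}^{n−1} ℓ(p_j)^{1/d} ≤ B·(log(n+1))^{1−1/d} and ℓ(p_n) ≤ B/(n+1)^{d−1}. -/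
theorem gp_step_sum (d : ℕ) (n : ℕ) (g : (Fin d → ℕ) → ℝ) (hg : ∀ v, 0 ≤ g v)
    (κ : (Fin d → ℕ) → Fin d)
    (hκ : ∀ v i, g (v + Pi.single (κ v) 1) ≤ g (v + Pi.single i 1)) :
    ((n : ℝ) + d) * ∑ v ∈ Finset.piAntidiag Finset.univ n, g (v + Pi.single (κ v) 1)
      ≤ ((n : ℝ) + 1) * ∑ w ∈ Finset.piAntidiag Finset.univ (n + 1), g w := by
  have h1 : ((n : ℝ) + d) * ∑ v ∈ Finset.piAntidiag Finset.univ n, g (v + Pi.single (κ v) 1)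
      ≤ ∑ v ∈ Finset.piAntidiag Finset.univ n, ∑ i : Fin d,
        ((v i : ℝ) + 1) * g (v + Pi.single i 1) := by
    rw [Finset.mul_sum]
    refine Finset.sum_le_sum fun v hv => ?_
    rw [Finset.mem_piAntidiag] at hv
    have : ((n : ℝ) + d) = ∑ i : Fin d, ((v i : ℝ) + 1) := by
      rw [Finset.sum_add_distrib, ← hv.1]
      push_cast
      simp
    rw [this, Finset.sum_mul]
    exact Finset.sum_le_sum fun i _ => mul_le_mul_of_nonneg_left (hκ v i) (by positivity)
  refine h1.trans ?_
  rw [Finset.sum_comm]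
  have h2 : ((n : ℝ) + 1) * ∑ w ∈ Finset.piAntidiag Finset.univ (n + 1), g w
      = ∑ i : Fin d, ∑ w ∈ Finset.piAntidiag Finset.univ (n + 1), (w i : ℝ) * g w := by
    rw [Finset.sum_comm, Finset.mul_sum]
    refine Finset.sum_congr rfl fun w hw => ?_
    rw [Finset.mem_piAntidiag] at hw
    rw [← Finset.sum_mul]
    congr 1
    have := hw.1
    exact_mod_cast this.symm
  rw [h2]
  refine Finset.sum_le_sum fun i _ => ?_
  have h3 : ∑ v ∈ Finset.piAntidiag Finset.univ n, ((v i : ℝ) + 1) * g (v + Pi.single i 1)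
      = ∑ w ∈ (Finset.piAntidiag Finset.univ n).image (fun v : Fin d → ℕ => v + Pi.single i 1),
        (w i : ℝ) * g w := by
    rw [Finset.sum_image (fun a _ b _ h => add_right_cancel h)]
    refine Finset.sum_congr rfl fun v _ => ?_
    simp
  rw [h3]
  refine Finset.sum_le_sum_of_subset_of_nonneg ?_ fun w _ _ => mul_nonneg (by positivity) (hg w)
  intro w hw
  rw [Finset.mem_image] at hw
  obtain ⟨v, hv, rfl⟩ := hw
  rw [Finset.mem_piAntidiag] at hv ⊢
  refine ⟨?_, fun _ _ => Finset.mem_univ _⟩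
  have := hv.1
  simp [Finset.sum_add_distrib, this]

theorem gp_path (m : ℕ) (n : ℕ) : ∀ f : ℕ → (Fin (m + 1) → ℕ) → ℝ, (∀ j v, 0 ≤ f j v) →
    ∃ p : ℕ → (Fin (m + 1) → ℕ), p 0 = 0 ∧
      (∀ j, j < n → ∃ k, p (j + 1) = p j + Pi.single k 1) ∧
      ∑ j ∈ Finset.range (n + 1), ((j + 1).ascFactorial m : ℝ) * f j (p j)
        ≤ (m.factorial : ℝ) * ∑ j ∈ Finset.range (n + 1),
          ∑ v ∈ Finset.piAntidiag Finset.univ j, f j v := by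
  induction n with
  | zero =>
    intro f hf
    refine ⟨fun _ => 0, rfl, by simp, ?_⟩
    simp [Nat.one_ascFactorial]
  | succ n ih =>
    intro f hf
    have hex : ∀ v : Fin (m + 1) → ℕ, ∃ k, ∀ i,
        f (n + 1) (v + Pi.single k 1) ≤ f (n + 1) (v + Pi.single i 1) :=
      fun v => Finite.exists_min fun i => f (n + 1) (v + Pi.single i 1)
    choose κ hκ using hex
    set c : ℝ := ((n : ℝ) + 1 + m) / (n + 1) with hc
    have hc0 : 0 ≤ c := by positivity
    have hstep := gp_step_sum (m + 1) n (f (n + 1)) (hf _) κ hκ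
    obtain ⟨p, hp0, hps, hp⟩ := ih
      (fun j v => f j v + if j = n then c * f (n + 1) (v + Pi.single (κ v) 1) else 0)
      (fun j v => add_nonneg (hf _ _) (by
        split_ifs
        · exact mul_nonneg hc0 (hf _ _)
        · exact le_rfl))
    refine ⟨fun j => if j ≤ n then p j else p n + Pi.single (κ (p n)) 1, by simp [hp0], ?_, ?_⟩
    · intro j hj
      rcases Nat.lt_succ_iff_lt_or_eq.mp hj with h | h
      · obtain ⟨k, hk⟩ := hps j h
        exact ⟨k, by simp [h.le, Nat.succ_le_of_lt h, hk]⟩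
      · subst h
        exact ⟨κ (p j), by simp⟩
    · rw [Finset.sum_range_succ, Finset.sum_range_succ _ (n + 1)]
      have e1 : ∑ j ∈ Finset.range (n + 1), ((j + 1).ascFactorial m : ℝ) *
          f j (if j ≤ n then p j else p n + Pi.single (κ (p n)) 1)
          = ∑ j ∈ Finset.range (n + 1), ((j + 1).ascFactorial m : ℝ) * f j (p j) := by
        refine Finset.sum_congr rfl fun j hj => ?_
        rw [if_pos (by simpa [Nat.lt_succ_iff] using hj)]
      rw [e1]
      simp only [Finset.sum_add_distrib, mul_add] at hp
      rw [Finset.sum_range_succ (fun j => ((j + 1).ascFactorial m : ℝ) * (if j = n then _ else _)),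
        Finset.sum_eq_zero (s := Finset.range n)
          (f := fun j => ((j + 1).ascFactorial m : ℝ) * (if j = n then _ else _)) (by
          intro j hj
          rw [if_neg (Finset.mem_range.mp hj).ne, mul_zero])] at hp
      have e2 : ∑ j ∈ Finset.range (n + 1), ∑ v ∈ Finset.piAntidiag Finset.univ j,
          (if j = n then c * f (n + 1) (v + Pi.single (κ v) 1) else 0)
          = ∑ v ∈ Finset.piAntidiag Finset.univ n, c * f (n + 1) (v + Pi.single (κ v) 1) := by
        rw [Finset.sum_range_succ, Finset.sum_eq_zero, zero_add]
        · simp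
        · intro j hj
          refine Finset.sum_eq_zero fun v _ => ?_
          rw [if_neg (Finset.mem_range.mp hj).ne]
      rw [e2] at hp
      simp only [if_true, zero_add, ← Finset.mul_sum] at hp
      have hW : ((n + 1).ascFactorial m : ℝ) * c = ((n + 1 + 1).ascFactorial m : ℝ) := by
        have := Nat.succ_ascFactorial (n + 1) m
        have h' : ((n : ℝ) + 1) * ((n + 1 + 1).ascFactorial m : ℝ)
            = ((n : ℝ) + 1 + m) * ((n + 1).ascFactorial m : ℝ) := by exact_mod_cast this
        rw [hc]
        field_simp
        linarith
      rw [← mul_assoc, hW] at hp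
      have h5 : c * ∑ v ∈ Finset.piAntidiag Finset.univ n, f (n + 1) (v + Pi.single (κ v) 1)
          ≤ ∑ v ∈ Finset.piAntidiag Finset.univ (n + 1), f (n + 1) v := by
        rw [hc, div_mul_eq_mul_div, div_le_iff₀ (by positivity)]
        push_cast at hstep
        linarith
      have h6 := mul_le_mul_of_nonneg_left h5 (Nat.cast_nonneg (α := ℝ) m.factorial)
      have h7 : ¬ (n + 1 ≤ n) := by omega
      simp only [if_neg h7]
      linarith

theorem gp_layers (d : ℕ) (ℓ : (Fin d → ℕ) → ℝ) (hpos : ∀ v, 0 < ℓ v) (hsum : Summable ℓ)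
    (n : ℕ) : ∑ j ∈ Finset.range n, ∑ v ∈ Finset.piAntidiag Finset.univ j, ℓ v ≤ ∑' v, ℓ v := by
  rw [← Finset.sum_biUnion]
  · exact hsum.sum_le_tsum _ fun v _ => (hpos v).le
  · intro a _ b _ hab
    refine Finset.disjoint_left.mpr fun v hv hv' => hab ?_
    rw [Finset.mem_piAntidiag] at hv hv'
    exact hv.1.symm.trans hv'.1

theorem gp_harm (n : ℕ) (hn : 1 ≤ n) :
    ∑ j ∈ Finset.range n, (1 / ((j : ℝ) + 1)) ≤ 3 * Real.log (n + 1) := by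
  have h := harmonic_le_one_add_log n
  have h1 : ((harmonic n : ℚ) : ℝ) = ∑ j ∈ Finset.range n, (1 / ((j : ℝ) + 1)) := by
    simp [harmonic]
  rw [h1] at h
  have hn' : (1 : ℝ) ≤ n := by exact_mod_cast hn
  have h2 : Real.log n ≤ Real.log (n + 1) := Real.log_le_log (by linarith) (by linarith)
  have h3 : Real.log 2 ≤ Real.log (n + 1) := Real.log_le_log (by norm_num) (by linarith)
  have := Real.log_two_gt_d9
  linarith

theorem geodesic_path_lemma (d : ℕ) (hd : 1 ≤ d)
    (ℓ : (Fin d → ℕ) → ℝ) (hpos : ∀ v, 0 < ℓ v) (hsum : Summable ℓ) :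
    ∃ B : ℝ, 0 < B ∧ ∀ n : ℕ, 1 ≤ n →
      ∃ p : ℕ → (Fin d → ℕ),
        p 0 = 0 ∧
        (∀ j, j < n → ∃ k : Fin d, p (j + 1) = Function.update (p j) k (p j k + 1)) ∧
        (∑ j ∈ Finset.range n, ℓ (p j) ^ ((1 : ℝ) / d))
          ≤ B * Real.log (n + 1) ^ (1 - (1 : ℝ) / d) ∧
        ℓ (p n) ≤ B / ((n : ℝ) + 1) ^ (d - 1) := by
  obtain ⟨m, rfl⟩ : ∃ m, d = m + 1 := ⟨d - 1, by omega⟩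
  set M : ℝ := (m.factorial : ℝ) * ∑' v, ℓ v with hM
  have hM0 : 0 ≤ M := mul_nonneg (by positivity) (tsum_nonneg fun v => (hpos v).le)
  refine ⟨3 * (1 + M), by positivity, fun n hn => ?_⟩
  obtain ⟨p, hp0, hps, hp⟩ := gp_path m n (fun _ => ℓ) (fun _ v => (hpos v).le)
  have hkey : ∑ j ∈ Finset.range (n + 1), ((j : ℝ) + 1) ^ m * ℓ (p j) ≤ M := by
    refine le_trans (Finset.sum_le_sum fun j _ => ?_) (hp.trans
      (mul_le_mul_of_nonneg_left (gp_layers _ ℓ hpos hsum (n + 1)) (by positivity)))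
    refine mul_le_mul_of_nonneg_right ?_ (hpos _).le
    have := Nat.pow_succ_le_ascFactorial (j + 1) m
    exact_mod_cast this
  rw [Finset.sum_range_succ] at hkey
  have hS0 : 0 ≤ ∑ j ∈ Finset.range n, ((j : ℝ) + 1) ^ m * ℓ (p j) :=
    Finset.sum_nonneg fun j _ => mul_nonneg (by positivity) (hpos _).le
  have hT0 : 0 ≤ ((n : ℝ) + 1) ^ m * ℓ (p n) := mul_nonneg (by positivity) (hpos _).le
  refine ⟨p, hp0, ?_, ?_, ?_⟩
  · intro j hj
    obtain ⟨k, hk⟩ := hps j hj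
    refine ⟨k, ?_⟩
    rw [hk]
    ext i
    by_cases h : i = k
    · subst h; simp
    · simp [h]
  · have hlog : 0 ≤ Real.log ((n : ℝ) + 1) := Real.log_nonneg (by linarith [Nat.cast_nonneg (α := ℝ) n])
    rcases Nat.eq_zero_or_pos m with rfl | hm
    · simp only [pow_zero, one_mul] at hkey hS0 hT0
      simp
      linarith
    · have hm' : (0 : ℝ) < m := by exact_mod_cast hm
      set a : ℝ := (1 : ℝ) / ((m + 1 : ℕ) : ℝ) with ha
      have ha0 : 0 < a := by positivity
      have ha1 : a < 1 := by
        rw [ha, div_lt_one (by positivity)]; push_cast; linarith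
      have hb : (m : ℝ) * a = 1 - a := by
        rw [ha]; push_cast; field_simp; ring
      have hH := Real.inner_le_Lp_mul_Lq_of_nonneg (Finset.range n) (p := 1 / a) (q := 1 / (1 - a))
        (f := fun j => (((j : ℝ) + 1) ^ m * ℓ (p j)) ^ a)
        (g := fun j => (1 / ((j : ℝ) + 1)) ^ (1 - a))
        (by
          rw [Real.holderConjugate_iff]
          refine ⟨by rw [lt_div_iff₀ ha0]; linarith, by simp⟩)
        (fun j _ => Real.rpow_nonneg (mul_nonneg (by positivity) (hpos _).le) _)
        (fun j _ => by positivity)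
      have e1 : ∀ j ∈ Finset.range n, (((j : ℝ) + 1) ^ m * ℓ (p j)) ^ a *
          (1 / ((j : ℝ) + 1)) ^ (1 - a) = ℓ (p j) ^ a := by
        intro j _
        rw [Real.mul_rpow (by positivity) (hpos _).le, ← Real.rpow_natCast, ← Real.rpow_mul
          (by positivity), hb, Real.div_rpow (by norm_num) (by positivity), Real.one_rpow]
        have : ((j : ℝ) + 1) ^ (1 - a) ≠ 0 := by positivity
        field_simp
      have e2 : ∀ j ∈ Finset.range n, ((((j : ℝ) + 1) ^ m * ℓ (p j)) ^ a) ^ (1 / a)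
          = ((j : ℝ) + 1) ^ m * ℓ (p j) := by
        intro j _
        rw [← Real.rpow_mul (mul_nonneg (by positivity) (hpos _).le), mul_one_div_cancel ha0.ne',
          Real.rpow_one]
      have e3 : ∀ j ∈ Finset.range n, ((1 / ((j : ℝ) + 1)) ^ (1 - a)) ^ (1 / (1 - a))
          = 1 / ((j : ℝ) + 1) := by
        intro j _
        rw [← Real.rpow_mul (by positivity), mul_one_div_cancel (by linarith), Real.rpow_one]
      rw [Finset.sum_congr rfl e1, Finset.sum_congr rfl e2, Finset.sum_congr rfl e3,
        one_div_one_div, one_div_one_div] at hH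
      refine hH.trans ?_
      have k1 : (∑ j ∈ Finset.range n, ((j : ℝ) + 1) ^ m * ℓ (p j)) ^ a ≤ 1 + M := by
        calc _ ≤ (1 + M) ^ a := Real.rpow_le_rpow hS0 (by linarith) ha0.le
          _ ≤ (1 + M) ^ (1 : ℝ) := Real.rpow_le_rpow_of_exponent_le (by linarith) ha1.le
          _ = _ := Real.rpow_one _
      have k2 : (∑ j ∈ Finset.range n, (1 / ((j : ℝ) + 1))) ^ (1 - a)
          ≤ 3 * Real.log (n + 1) ^ (1 - a) := by
        calc _ ≤ (3 * Real.log (n + 1)) ^ (1 - a) :=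
              Real.rpow_le_rpow (Finset.sum_nonneg fun j _ => by positivity) (gp_harm n hn)
                (by linarith)
          _ = 3 ^ (1 - a) * Real.log (n + 1) ^ (1 - a) := Real.mul_rpow (by norm_num) hlog
          _ ≤ 3 ^ (1 : ℝ) * Real.log (n + 1) ^ (1 - a) := by
              refine mul_le_mul_of_nonneg_right ?_ (Real.rpow_nonneg hlog _)
              exact Real.rpow_le_rpow_of_exponent_le (by norm_num) (by linarith)
          _ = _ := by rw [Real.rpow_one]
      calc _ ≤ (1 + M) * (3 * Real.log (n + 1) ^ (1 - a)) :=
            mul_le_mul k1 k2 (Real.rpow_nonneg (Finset.sum_nonneg fun j _ => by positivity) _)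
              (by linarith)
        _ = _ := by ring
  · rw [le_div_iff₀ (by positivity), Nat.add_sub_cancel]
    linarith
end

section
/- Let d ≥ 2 and consider the Markov chain (X_n)_{n ≥ 0} on ℕ_0^d with X_0 = (0,…,0) and transition probabilities P(X_{n+1} = v + e_j | X_n = v) = (1 + v_j)/(v_1 + ⋯ + v_d + d). Let ℓ : ℕ_0^d → (0,∞) satisfy L := Σ_{v} ℓ(v) < ∞, and let A_d > 0 be a constant such that |S_n| ≥ A_d·(n+1)^{d−1} for all n ≥ 0, where S_n is the sphere of radius n. Then for every n ≥ 1, E[Σ_{j=0}^{n−1} ℓ(X_j)^{1/d}] ≤ (L/A_d)^{1/d} · (Σ_{j=1}^{n} 1/j)^{1−1/d}. -/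
open Finset in
/-- Hölder inequality in the weighted exponent form. -/
lemma holder_aux {ι : Type*} (s : Finset ι) (a b : ι → ℝ) (θ : ℝ) (h0 : 0 < θ) (h1 : θ < 1)
    (ha : ∀ i, 0 ≤ a i) (hb : ∀ i, 0 ≤ b i) :
    ∑ i ∈ s, a i ^ θ * b i ^ (1 - θ) ≤ (∑ i ∈ s, a i) ^ θ * (∑ i ∈ s, b i) ^ (1 - θ) := by
  have h2 : 0 < 1 - θ := by linarith
  have hpq : Real.HolderConjugate (θ⁻¹) ((1 - θ)⁻¹) := by
    rw [Real.holderConjugate_iff]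
    refine ⟨(one_lt_inv₀ h0).2 h1, by simp⟩
  have := Real.inner_le_Lp_mul_Lq_of_nonneg (s := s) (f := fun i => a i ^ θ)
    (g := fun i => b i ^ (1 - θ)) hpq
    (fun i _ => Real.rpow_nonneg (ha i) _) (fun i _ => Real.rpow_nonneg (hb i) _)
  simpa [Real.rpow_rpow_inv, ha, hb, h0.ne', h2.ne'] using this

lemma card_sphere (d n : ℕ) :
    Nat.card {w : Fin d → ℕ // (∑ i, w i) = n} = (d + n - 1).choose n := by
  rw [← Nat.card_congr (Sym.equivNatSumOfFintype (Fin d) n), Nat.card_eq_fintype_card,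
    Sym.card_sym_eq_choose, Fintype.card_fin]

lemma card_sphere_finset (d n : ℕ) :
    ((Finset.univ : Finset (Fin d)).piAntidiag n).card = (d + n - 1).choose n := by
  rw [← card_sphere, Nat.subtype_card]
  simp

lemma choose_rec (d n : ℕ) (hd : 2 ≤ d) :
    (((d + (n + 1) - 1).choose (n + 1) : ℕ) : ℝ) * ((n : ℝ) + 1)
      = ((d + n - 1).choose n : ℝ) * ((n : ℝ) + d) := by
  obtain ⟨e, rfl⟩ : ∃ e, d = e + 1 := ⟨d - 1, by omega⟩
  have := Nat.add_one_mul_choose_eq (e + n) n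
  have h1 : e + 1 + (n + 1) - 1 = e + n + 1 := by omega
  have h2 : e + 1 + n - 1 = e + n := by omega
  rw [h1, h2]
  have h3 : (((e + n + 1) * (e + n).choose n : ℕ) : ℝ)
    = (((e + n + 1).choose (n + 1) * (n + 1) : ℕ) : ℝ) := by rw [this]
  push_cast at h3 ⊢
  linarith

/-- The walk is uniformly distributed on the sphere. -/
lemma mu_uniform (d : ℕ) (hd : 2 ≤ d)
    (μ : ℕ → (Fin d → ℕ) → ℝ)
    (h0 : ∀ v : Fin d → ℕ, μ 0 v = if v = 0 then 1 else 0)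
    (hstep : ∀ (n : ℕ) (w : Fin d → ℕ), μ (n + 1) w =
      ∑ j : Fin d,
        if 1 ≤ w j then
          μ n (Function.update w j (w j - 1)) * (w j : ℝ)
            / (((∑ i, w i : ℕ) : ℝ) + (d : ℝ) - 1)
        else 0) (n : ℕ) :
    ∀ v, μ n v = if ∑ i, v i = n then (((d + n - 1).choose n : ℕ) : ℝ)⁻¹ else 0 := by
  induction n with
  | zero =>
    intro v
    rw [h0]
    simp [funext_iff]
  | succ n ih =>
    intro w
    rw [hstep]
    have key : ∀ j : Fin d, (if 1 ≤ w j then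
          μ n (Function.update w j (w j - 1)) * (w j : ℝ)
            / (((∑ i, w i : ℕ) : ℝ) + (d : ℝ) - 1)
        else 0) = if ∑ i, w i = n + 1 then
          (((d + n - 1).choose n : ℕ) : ℝ)⁻¹ * (w j : ℝ) / ((n : ℝ) + d) else 0 := by
      intro j
      by_cases hj : 1 ≤ w j
      · have hs : ∑ i, Function.update w j (w j - 1) i + 1 = ∑ i, w i := by
          rw [Finset.sum_update_of_mem (Finset.mem_univ j),
            ← Finset.add_sum_erase _ w (Finset.mem_univ j), Finset.sdiff_singleton_eq_erase]
          omega
        rw [if_pos hj, ih]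
        by_cases hw : ∑ i, w i = n + 1
        · rw [if_pos (by omega), if_pos hw, hw]
          congr 1
          push_cast
          ring
        · rw [if_neg (by omega), if_neg hw]
          simp
      · have : w j = 0 := by omega
        simp [this]
    rw [Finset.sum_congr rfl (fun j _ => key j)]
    by_cases hw : ∑ i, w i = n + 1
    · simp only [hw, if_true]
      rw [← Finset.sum_div, ← Finset.mul_sum]
      have hc : (∑ i, (w i : ℝ)) = (n : ℝ) + 1 := by exact_mod_cast hw
      rw [hc]
      have hr := choose_rec d n hd
      have p1 : (0 : ℝ) < ((d + n - 1).choose n : ℕ) := by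
        exact_mod_cast Nat.choose_pos (by omega)
      have p2 : (0 : ℝ) < ((d + (n + 1) - 1).choose (n + 1) : ℕ) := by
        exact_mod_cast Nat.choose_pos (by omega)
      have p3 : (0 : ℝ) < (n : ℝ) + d := by positivity
      field_simp
      linarith
    · simp [hw]

/-- **Expectation estimate along the random walk.** Consider the Markov chain on `ℕ₀^d`
(`d ≥ 2`) started at the origin with transitions `P(v → v + e_j) = (1+v_j)/(∑ᵢ v_i + d)`;
`μ n` denotes its distribution at time `n`.  Let `ℓ : ℕ₀^d → (0,∞)` be summable with sum
`L`, and let `A > 0` satisfy `|S_n| ≥ A (n+1)^{d-1}` for all `n`, where `S_n` is the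
sphere of radius `n`.  Then for every `n ≥ 1`,
`E[∑_{j<n} ℓ(X_j)^{1/d}] ≤ (L/A)^{1/d} (∑_{j=1}^n 1/j)^{1-1/d}`. -/
theorem expectation_estimate (d : ℕ) (hd : 2 ≤ d)
    (μ : ℕ → (Fin d → ℕ) → ℝ)
    (h0 : ∀ v : Fin d → ℕ, μ 0 v = if v = 0 then 1 else 0)
    (hstep : ∀ (n : ℕ) (w : Fin d → ℕ), μ (n + 1) w =
      ∑ j : Fin d,
        if 1 ≤ w j then
          μ n (Function.update w j (w j - 1)) * (w j : ℝ)
            / (((∑ i, w i : ℕ) : ℝ) + (d : ℝ) - 1)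
        else 0)
    (ℓ : (Fin d → ℕ) → ℝ) (hpos : ∀ v, 0 < ℓ v) (hsum : Summable ℓ)
    (A : ℝ) (hA : 0 < A)
    (hcard : ∀ n : ℕ,
      A * ((n : ℝ) + 1) ^ (d - 1)
        ≤ (Nat.card {w : Fin d → ℕ // (∑ i, w i) = n} : ℝ)) :
    ∀ n : ℕ, 1 ≤ n →
      (∑ j ∈ Finset.range n, ∑' v : Fin d → ℕ, μ j v * ℓ v ^ ((1 : ℝ) / d))
        ≤ ((∑' v, ℓ v) / A) ^ ((1 : ℝ) / d)
          * (∑ j ∈ Finset.Icc 1 n, (1 : ℝ) / j) ^ (1 - (1 : ℝ) / d) := by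
  intro n hn
  have hu := mu_uniform d hd μ h0 hstep
  simp only [card_sphere] at hcard
  have hd2 : (2 : ℝ) ≤ d := by exact_mod_cast hd
  set θ : ℝ := (1 : ℝ) / d with hθ
  have t0 : 0 < θ := by positivity
  have t1 : θ < 1 := by
    rw [hθ, div_lt_one (by linarith)]
    linarith
  set S : ℕ → Finset (Fin d → ℕ) := fun j => (Finset.univ : Finset (Fin d)).piAntidiag j with hS
  have memS : ∀ j v, v ∈ S j ↔ ∑ i, v i = j := by intro j v; simp [hS]
  set a : ℕ → ℝ := fun j => ∑ v ∈ S j, ℓ v with ha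
  have a0 : ∀ j, 0 ≤ a j := fun j => Finset.sum_nonneg fun v _ => (hpos v).le
  have step1 : ∀ j, ∑' v : Fin d → ℕ, μ j v * ℓ v ^ θ
      ≤ (A⁻¹) ^ θ * (a j ^ θ * ((1 : ℝ) / ((j : ℝ) + 1)) ^ (1 - θ)) := by
    intro j
    set N : ℝ := (((d + j - 1).choose j : ℕ) : ℝ) with hN
    have hNA := hcard j
    have hB : 0 < A * ((j : ℝ) + 1) ^ (d - 1) := by positivity
    have hNpos : 0 < N := lt_of_lt_of_le hB hNA
    rw [tsum_eq_sum (s := S j)]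
    swap
    · intro v hv
      rw [memS] at hv
      rw [hu, if_neg hv, zero_mul]
    have e1 : ∑ v ∈ S j, μ j v * ℓ v ^ θ = N⁻¹ * ∑ v ∈ S j, ℓ v ^ θ := by
      rw [Finset.mul_sum]
      refine Finset.sum_congr rfl fun v hv => ?_
      rw [hu, if_pos ((memS j v).1 hv)]
    have e2 := holder_aux (S j) ℓ (fun _ => 1) θ t0 t1 (fun v => (hpos v).le) (fun _ => zero_le_one)
    have e3 : (∑ v ∈ S j, (1 : ℝ)) = N := by
      simp [hS, card_sphere_finset, hN]
    rw [e3] at e2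
    simp only [Real.one_rpow, mul_one] at e2
    rw [e1]
    have e4 : N⁻¹ * N ^ (1 - θ) = (N⁻¹) ^ θ := by
      rw [Real.rpow_sub hNpos, Real.rpow_one, Real.inv_rpow hNpos.le]
      field_simp
    have e5 : (N⁻¹) ^ θ ≤ ((A * ((j : ℝ) + 1) ^ (d - 1))⁻¹) ^ θ :=
      Real.rpow_le_rpow (by positivity) (inv_anti₀ hB hNA) t0.le
    have e6 : ((A * ((j : ℝ) + 1) ^ (d - 1))⁻¹) ^ θ
        = (A⁻¹) ^ θ * ((1 : ℝ) / ((j : ℝ) + 1)) ^ (1 - θ) := by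
      rw [mul_inv, Real.mul_rpow (by positivity) (by positivity), ← inv_pow, ← Real.rpow_natCast,
        ← Real.rpow_mul (by positivity), one_div]
      congr 2
      rw [Nat.cast_sub (by omega), hθ]
      field_simp
      simp
    calc N⁻¹ * ∑ v ∈ S j, ℓ v ^ θ ≤ N⁻¹ * (a j ^ θ * N ^ (1 - θ)) :=
          mul_le_mul_of_nonneg_left e2 (by positivity)
      _ = a j ^ θ * (N⁻¹) ^ θ := by rw [← e4]; ring
      _ ≤ a j ^ θ * ((A⁻¹) ^ θ * ((1 : ℝ) / ((j : ℝ) + 1)) ^ (1 - θ)) := by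
          rw [← e6]
          exact mul_le_mul_of_nonneg_left e5 (Real.rpow_nonneg (a0 j) _)
      _ = _ := by ring
  have step2 : ∑ j ∈ Finset.range n, a j ≤ ∑' v, ℓ v := by
    have hdisj : (↑(Finset.range n) : Set ℕ).PairwiseDisjoint S := by
      intro i _ j _ hij
      rw [Function.onFun, Finset.disjoint_left]
      intro v hv hv'
      rw [memS] at hv hv'
      exact hij (hv.symm.trans hv')
    rw [ha, ← Finset.sum_biUnion hdisj]
    exact hsum.sum_le_tsum _ fun v _ => (hpos v).le
  have step3 : ∑ j ∈ Finset.range n, (1 : ℝ) / ((j : ℝ) + 1) = ∑ j ∈ Finset.Icc 1 n, (1 : ℝ) / j := by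
    rw [Finset.range_eq_Ico, ← Finset.Ico_add_one_right_eq_Icc,
      ← Finset.sum_Ico_add' (fun j : ℕ => (1 : ℝ) / j) 0 n 1]
    simp
  have hL : 0 ≤ ∑' v, ℓ v := tsum_nonneg fun v => (hpos v).le
  calc _ ≤ ∑ j ∈ Finset.range n, (A⁻¹) ^ θ * (a j ^ θ * ((1 : ℝ) / ((j : ℝ) + 1)) ^ (1 - θ)) :=
        Finset.sum_le_sum fun j _ => step1 j
    _ = (A⁻¹) ^ θ * ∑ j ∈ Finset.range n, (a j ^ θ * ((1 : ℝ) / ((j : ℝ) + 1)) ^ (1 - θ)) := by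
        rw [Finset.mul_sum]
    _ ≤ (A⁻¹) ^ θ * ((∑ j ∈ Finset.range n, a j) ^ θ
          * (∑ j ∈ Finset.range n, (1 : ℝ) / ((j : ℝ) + 1)) ^ (1 - θ)) :=
        mul_le_mul_of_nonneg_left (holder_aux _ a _ θ t0 t1 a0 (fun j => by positivity))
          (by positivity)
    _ ≤ (A⁻¹) ^ θ * ((∑' v, ℓ v) ^ θ * (∑ j ∈ Finset.Icc 1 n, (1 : ℝ) / j) ^ (1 - θ)) := by
        rw [step3]
        have := Real.rpow_le_rpow (Finset.sum_nonneg fun j _ => a0 j) step2 t0.le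
        gcongr
    _ = _ := by
        rw [div_eq_mul_inv, Real.mul_rpow hL (by positivity)]
        ring
end

section
/- Let f and g be commuting C^1 diffeomorphisms of [0,1] onto itself. If p ∈ [0,1] is a fixed point of g such that the forward f-orbit {f^n(p) : n ∈ ℕ} is an infinite set, then Dg(p) = 1. In particular, g has no hyperbolic fixed point whose f-orbit is infinite. -/
open Set Filter Topology

/-- Commuting maps: a contraction rate at `p` is inherited by `f p`. -/
lemma rate_contra {X : Type*} [MetricSpace X] (f h : X → X) (p : X) [(𝓝[≠] p).NeBot]
    (hf : Continuous f) (hinj : Function.Injective f) (hc : ∀ x, f (h x) = h (f x))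
    (a b C : ℝ) (ha0 : 0 < a) (ha1 : a < 1) (hab : a < b)
    (hC : ∀ᶠ x in 𝓝 p, dist (f x) (f p) ≤ C * dist x p)
    (hA : ∀ᶠ x in 𝓝 p, dist (h x) p ≤ a * dist x p)
    (hB : ∀ᶠ y in 𝓝 (f p), b * dist y (f p) ≤ dist (h y) (f p)) : False := by
  have hB' := hf.continuousAt.eventually hB
  obtain ⟨ε, hε, hball⟩ := Metric.eventually_nhds_iff.1 (hC.and (hA.and hB'))
  obtain ⟨x, hxε, hxp⟩ : ∃ x, dist x p < ε ∧ x ≠ p := by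
    have h1 : ∀ᶠ x in 𝓝[≠] p, dist x p < ε :=
      mem_nhdsWithin_of_mem_nhds (Metric.ball_mem_nhds p hε)
    exact (h1.and self_mem_nhdsWithin).exists
  have hd : 0 < dist x p := dist_pos.2 hxp
  have hfd : 0 < dist (f x) (f p) := dist_pos.2 (hinj.ne hxp)
  have key : ∀ n : ℕ, dist (h^[n] x) p ≤ a ^ n * dist x p ∧
      b ^ n * dist (f x) (f p) ≤ dist (f (h^[n] x)) (f p) := by
    intro n
    induction n with
    | zero => simp
    | succ n ih =>
      have hlt : dist (h^[n] x) p < ε := by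
        refine lt_of_le_of_lt (ih.1.trans ?_) hxε
        exact mul_le_of_le_one_left hd.le (pow_le_one₀ ha0.le ha1.le)
      obtain ⟨-, h2, h3⟩ := hball hlt
      rw [Function.iterate_succ_apply', hc]
      constructor
      · calc _ ≤ _ := h2
          _ ≤ a * (a ^ n * dist x p) := by gcongr; exact ih.1
          _ = _ := by ring
      · calc _ = b * (b ^ n * dist (f x) (f p)) := by ring
          _ ≤ b * dist (f (h^[n] x)) (f p) := by
            have : 0 < b := ha0.trans hab
            gcongr; exact ih.2
          _ ≤ _ := h3
  have hbd : ∀ n : ℕ, (b / a) ^ n ≤ |C| * dist x p / dist (f x) (f p) := by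
    intro n
    have hlt : dist (h^[n] x) p < ε := by
      refine lt_of_le_of_lt ((key n).1.trans ?_) hxε
      exact mul_le_of_le_one_left hd.le (pow_le_one₀ ha0.le ha1.le)
    have h1 := (hball hlt).1
    rw [div_pow, div_le_div_iff₀ (by positivity) hfd]
    calc _ ≤ _ := (key n).2
      _ ≤ _ := h1
      _ ≤ |C| * (a ^ n * dist x p) := by
        gcongr
        · exact le_abs_self C
        · exact (key n).1
      _ = _ := by ring
  obtain ⟨n, hn⟩ := pow_unbounded_of_one_lt (|C| * dist x p / dist (f x) (f p))
    ((one_lt_div ha0).2 hab)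
  exact absurd (hbd n) (not_le.2 hn)

lemma tendsto_val_Icc (p : Icc (0:ℝ) 1) :
    Tendsto (Subtype.val : Icc (0:ℝ) 1 → ℝ) (𝓝 p) (𝓝[Icc (0:ℝ) 1] (p:ℝ)) :=
  tendsto_nhdsWithin_iff.2 ⟨continuous_subtype_val.continuousAt, Eventually.of_forall fun x => x.2⟩

lemma upper_rate (F : Icc (0:ℝ) 1 → Icc (0:ℝ) 1) (f : ℝ → ℝ) (hF : ∀ x, (F x : ℝ) = f x)
    (p : Icc (0:ℝ) 1) (D a : ℝ) (hD : HasDerivWithinAt f D (Icc 0 1) p) (ha : |D| < a) :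
    ∀ᶠ x in 𝓝 p, dist (F x) (F p) ≤ a * dist x p := by
  have h := (hD.isLittleO.def (sub_pos.2 ha))
  filter_upwards [(tendsto_val_Icc p).eventually h] with x hx
  rw [Subtype.dist_eq, Subtype.dist_eq, hF, hF, Real.dist_eq, Real.dist_eq]
  simp only [Real.norm_eq_abs, smul_eq_mul] at hx
  have h2 : |(x - p : ℝ) * D| = |D| * |(x - p : ℝ)| := by rw [abs_mul, mul_comm]
  have h3 := abs_add_le (f x - f p - (x - p) * D) ((x - p) * D)
  rw [sub_add_cancel, h2] at h3
  linarith

lemma lower_rate (F : Icc (0:ℝ) 1 → Icc (0:ℝ) 1) (f : ℝ → ℝ) (hF : ∀ x, (F x : ℝ) = f x)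
    (p : Icc (0:ℝ) 1) (D a : ℝ) (hD : HasDerivWithinAt f D (Icc 0 1) p) (ha : a < |D|) :
    ∀ᶠ x in 𝓝 p, a * dist x p ≤ dist (F x) (F p) := by
  have h := (hD.isLittleO.def (sub_pos.2 ha))
  filter_upwards [(tendsto_val_Icc p).eventually h] with x hx
  rw [Subtype.dist_eq, Subtype.dist_eq, hF, hF, Real.dist_eq, Real.dist_eq]
  simp only [Real.norm_eq_abs, smul_eq_mul] at hx
  have h2 : |(x - p : ℝ) * D| = |D| * |(x - p : ℝ)| := by rw [abs_mul, mul_comm]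
  have h3 := abs_sub_abs_le_abs_sub ((x - p : ℝ) * D) (f x - f p)
  rw [abs_sub_comm ((x - p : ℝ) * D), h2] at h3
  linarith


/-- **Derivative at a fixed point with infinite orbit.** Let `f` and `g` be commuting
`C¹` diffeomorphisms of `[0,1]` onto itself.  If `p ∈ [0,1]` is a fixed point of `g`
whose forward `f`-orbit `{f^[n] p : n ∈ ℕ}` is infinite, then `Dg(p) = 1`; in
particular `p` is not a hyperbolic fixed point of `g`. -/
theorem deriv_one_at_fixed_point_with_infinite_orbit (f g : ℝ → ℝ)
    (hfbij : Set.BijOn f (Set.Icc (0 : ℝ) 1) (Set.Icc (0 : ℝ) 1))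
    (hgbij : Set.BijOn g (Set.Icc (0 : ℝ) 1) (Set.Icc (0 : ℝ) 1))
    (hfC1 : ContDiffOn ℝ 1 f (Set.Icc (0 : ℝ) 1))
    (hgC1 : ContDiffOn ℝ 1 g (Set.Icc (0 : ℝ) 1))
    (hcomm : ∀ x ∈ Set.Icc (0 : ℝ) 1, f (g x) = g (f x))
    (p : ℝ) (hp : p ∈ Set.Icc (0 : ℝ) 1) (hfix : g p = p)
    (hinf : (Set.range fun n : ℕ => f^[n] p).Infinite) :
    derivWithin g (Set.Icc (0 : ℝ) 1) p = 1 := by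
  set I := Icc (0:ℝ) 1 with hI
  set D := derivWithin g I with hDdef
  have hgd : ∀ x ∈ I, HasDerivWithinAt g (D x) I x := fun x hx =>
    ((hgC1.differentiableOn one_ne_zero) x hx).hasDerivWithinAt
  have hfd : ∀ x ∈ I, HasDerivWithinAt f (derivWithin f I x) I x := fun x hx =>
    ((hfC1.differentiableOn one_ne_zero) x hx).hasDerivWithinAt
  have hDc : ContinuousOn D I :=
    hgC1.continuousOn_derivWithin (uniqueDiffOn_Icc zero_lt_one) le_rfl
  -- orbit
  have horb : ∀ n : ℕ, f^[n] p ∈ I ∧ g (f^[n] p) = f^[n] p := by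
    intro n
    induction n with
    | zero => exact ⟨hp, hfix⟩
    | succ n ih =>
      rw [Function.iterate_succ_apply']
      exact ⟨hfbij.mapsTo ih.1, by rw [← hcomm _ ih.1, ih.2]⟩
  have hfp : f p ≠ p := by
    intro h
    apply hinf
    apply (Set.finite_singleton p).subset
    rintro _ ⟨n, rfl⟩
    exact Function.iterate_fixed h n
  -- monotone
  have hmono : StrictMonoOn g I := by
    rcases hgC1.continuousOn.strictMonoOn_of_injOn_Icc' zero_le_one hgbij.injOn with h | h
    · exact h
    · exfalso
      have h1 := horb 1
      simp only [Function.iterate_one] at h1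
      rcases lt_or_gt_of_ne hfp with hl | hl
      · have := h h1.1 hp hl
        rw [h1.2, hfix] at this
        linarith
      · have := h hp h1.1 hl
        rw [h1.2, hfix] at this
        linarith
  have hD0 : ∀ x, 0 ≤ D x := fun x => hmono.monotoneOn.derivWithin_nonneg
  -- subtype maps
  let F : I → I := fun x => ⟨f x, hfbij.mapsTo x.2⟩
  let G : I → I := fun x => ⟨g x, hgbij.mapsTo x.2⟩
  have hFc : Continuous F := (continuousOn_iff_continuous_restrict.1 hfC1.continuousOn).subtype_mk _
  have hGc : Continuous G := (continuousOn_iff_continuous_restrict.1 hgC1.continuousOn).subtype_mk _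
  have hFi : Function.Injective F := fun x y h =>
    Subtype.ext (hfbij.injOn x.2 y.2 (congrArg Subtype.val h))
  have hGb : Function.Bijective G := by
    constructor
    · exact fun x y h => Subtype.ext (hgbij.injOn x.2 y.2 (congrArg Subtype.val h))
    · intro y
      obtain ⟨x, hx, hxy⟩ := hgbij.surjOn y.2
      exact ⟨⟨x, hx⟩, Subtype.ext hxy⟩
  have hFG : ∀ x, F (G x) = G (F x) := fun x => Subtype.ext (hcomm x x.2)
  let E : I ≃ₜ I := Continuous.homeoOfEquivCompactToT2 (f := Equiv.ofBijective G hGb) hGc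
  have hE : ∀ x, E x = G x := fun x => rfl
  have hnb : ∀ x : I, (𝓝[≠] x).NeBot := by
    intro x
    haveI : ConnectedSpace I := Subtype.connectedSpace (isConnected_Icc zero_le_one)
    haveI : Nontrivial I := ⟨⟨0, by simp [hI]⟩, ⟨1, by simp [hI]⟩, by simp⟩
    infer_instance
  have hLip : ∀ x : I, ∀ᶠ y in 𝓝 x, dist (F y) (F x) ≤
      (|derivWithin f I x| + 1) * dist y x := fun x =>
    upper_rate F f (fun _ => rfl) x _ _ (hfd x x.2) (lt_add_one _)
  have hdown : ∀ x ∈ I, g x = x → D x < 1 → D (f x) ≤ D x := by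
    intro x hx hgx h1
    by_contra hlt
    rw [not_le] at hlt
    obtain ⟨a, ha, ha'⟩ := exists_between (lt_min h1 hlt)
    obtain ⟨b, hb, hb'⟩ := exists_between (ha'.trans_le (min_le_right _ _))
    let q : I := ⟨x, hx⟩
    have hGq : G q = q := Subtype.ext hgx
    have hGFq : G (F q) = F q := by rw [← hFG, hGq]
    haveI := hnb q
    have hA := upper_rate G g (fun _ => rfl) q _ a (hgd x hx) (by rwa [abs_of_nonneg (hD0 _)])
    have hB := lower_rate G g (fun _ => rfl) (F q) _ b (hgd (f x) (F q).2)
      (by rwa [abs_of_nonneg (hD0 _)])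
    rw [hGq] at hA
    rw [hGFq] at hB
    exact rate_contra F G q hFc hFi hFG a b _ ((hD0 x).trans_lt ha)
      (ha'.trans_le (min_le_left _ _)) hb (hLip q) hA hB
  have hup : ∀ x ∈ I, g x = x → 1 < D x → D x ≤ D (f x) := by
    intro x hx hgx h1
    by_contra hlt
    rw [not_le] at hlt
    obtain ⟨b, hb, hb'⟩ := exists_between (max_lt h1 hlt)
    obtain ⟨a, ha, ha'⟩ := exists_between hb'
    have hb1 : 1 < b := (le_max_left _ _).trans_lt hb
    have hb0 : 0 < b := by linarith
    have ha0 : 0 < a := by linarith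
    let q : I := ⟨x, hx⟩
    have hGq : G q = q := Subtype.ext hgx
    have hGFq : G (F q) = F q := by rw [← hFG, hGq]
    have hEq : E.symm q = q := by rw [E.symm_apply_eq, hE, hGq]
    have hEFq : E.symm (F q) = F q := by rw [E.symm_apply_eq, hE, hGFq]
    haveI := hnb q
    have hA := lower_rate G g (fun _ => rfl) q _ a (hgd x hx) (by rwa [abs_of_nonneg (hD0 _)])
    have hB := upper_rate G g (fun _ => rfl) (F q) _ b (hgd (f x) (F q).2)
      (by rw [abs_of_nonneg (hD0 _)]; exact (le_max_right _ _).trans_lt hb)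
    rw [hGq] at hA
    rw [hGFq] at hB
    have hGE : ∀ y, G (E.symm y) = y := fun y => E.apply_symm_apply y
    have tA : Tendsto E.symm (𝓝 q) (𝓝 q) := by
      have := E.symm.continuous.tendsto q
      rwa [hEq] at this
    have tB : Tendsto E.symm (𝓝 (F q)) (𝓝 (F q)) := by
      have := E.symm.continuous.tendsto (F q)
      rwa [hEFq] at this
    refine rate_contra F E.symm q hFc hFi ?_ a⁻¹ b⁻¹ _ (by positivity)
      (inv_lt_one_of_one_lt₀ (hb1.trans ha)) (inv_strictAnti₀ hb0 ha) (hLip q) ?_ ?_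
    · intro y
      rw [eq_comm, E.symm_apply_eq, hE, ← hFG, hGE]
    · filter_upwards [tA.eventually hA] with y hy
      rw [hGE] at hy
      rwa [le_inv_mul_iff₀ ha0]
    · filter_upwards [tB.eventually hB] with y hy
      rw [hGE] at hy
      rwa [inv_mul_le_iff₀ hb0]
  -- accumulation point
  have hsub : (Set.range fun n : ℕ => f^[n] p) ⊆ I := by
    rintro _ ⟨n, rfl⟩
    exact (horb n).1
  obtain ⟨q, hq, hacc⟩ := hinf.exists_accPt_of_subset_isCompact isCompact_Icc hsub
  set S := Set.range fun n : ℕ => f^[n] p with hS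
  have hcl : q ∈ closure S := mem_closure_iff_clusterPt.2 hacc.clusterPt
  haveI : (𝓝[S] q).NeBot := mem_closure_iff_nhdsWithin_neBot.1 hcl
  have hgS : ∀ y ∈ S, g y = y := by
    rintro _ ⟨n, rfl⟩
    exact (horb n).2
  have hgq : g q = q := by
    have h1 : Tendsto g (𝓝[S] q) (𝓝 (g q)) := (hgC1.continuousOn q hq).mono hsub
    have h2 : Tendsto g (𝓝[S] q) (𝓝 q) :=
      (tendsto_id.mono_left nhdsWithin_le_nhds).congr'
        (by filter_upwards [self_mem_nhdsWithin] with y hy using (hgS y hy).symm)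
    exact tendsto_nhds_unique h1 h2
  have hDq : D q = 1 := by
    have h1 := (hgd q hq).mono hsub
    have h2 : HasDerivWithinAt g 1 S q := (hasDerivWithinAt_id q S).congr hgS hgq
    exact (uniqueDiffWithinAt_iff_accPt.2 hacc).eq_deriv _ h1 h2
  have hDt : Tendsto D (𝓝[S] q) (𝓝 1) := by
    have := (hDc q hq).mono hsub
    rw [← hDq]
    exact this
  rcases lt_trichotomy (D p) 1 with h | h | h
  · exfalso
    have hall : ∀ n : ℕ, D (f^[n] p) ≤ D p := by
      intro n
      induction n with
      | zero => exact le_rfl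
      | succ n ih =>
        rw [Function.iterate_succ_apply']
        exact (hdown _ (horb n).1 (horb n).2 (ih.trans_lt h)).trans ih
    have := le_of_tendsto hDt (b := D p) (by
      filter_upwards [self_mem_nhdsWithin] with y hy
      obtain ⟨n, rfl⟩ := hy
      exact hall n)
    linarith
  · exact h
  · exfalso
    have hall : ∀ n : ℕ, D p ≤ D (f^[n] p) := by
      intro n
      induction n with
      | zero => exact le_rfl
      | succ n ih =>
        rw [Function.iterate_succ_apply']
        exact ih.trans (hup _ (horb n).1 (horb n).2 (h.trans_le ih))
    have := ge_of_tendsto hDt (b := D p) (by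
      filter_upwards [self_mem_nhdsWithin] with y hy
      obtain ⟨n, rfl⟩ := hy
      exact hall n)
    linarith
end

section
/- Let α_1 > 0 and α_2 > 0 satisfy α_1 + α_2 = 1. For n ≥ 0 define the rectangles Q(2n+1) := [[4^{nα_1}, 4^{(n+1)α_1}]] × [[4^{nα_2}, 4^{(n+2)α_2}]] and Q(2n+2) := [[4^{nα_1}, 4^{(n+2)α_1}]] × [[4^{(n+1)α_2}, 4^{(n+2)α_2}]] in ℤ², where [[x,y]] denotes the set of integers lying between x and y. Then the sequence (Q(m))_{m ≥ 1} has multiplicity 4: no point of ℤ² is contained in more than 4 of the sets Q(m). -/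
theorem card_le_two_of_close (t : Finset ℕ)
    (h : ∀ x ∈ t, ∀ y ∈ t, x ≤ y + 2 ∧ x % 2 = y % 2) : t.card ≤ 2 := by
  rcases t.eq_empty_or_nonempty with rfl | hne
  · simp
  · have hsub : t ⊆ {t.min' hne, t.min' hne + 2} := by
      intro x hx
      have h1 := h x hx _ (t.min'_mem hne)
      have h2 := t.min'_le x hx
      simp only [Finset.mem_insert, Finset.mem_singleton]
      omega
    exact (Finset.card_le_card hsub).trans Finset.card_le_two

theorem le_of_rpow_le {a x y z : ℝ} (ha : 0 < a) (h : (4 : ℝ) ^ (x * a) ≤ z)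
    (h' : z ≤ (4 : ℝ) ^ (y * a)) : x ≤ y := by
  have h3 := (Real.rpow_le_rpow_left_iff (by norm_num : (1 : ℝ) < 4)).1 (h.trans h')
  exact le_of_mul_le_mul_right h3 ha

/-- **Multiplicity of the sequence of rectangles.** Let `α₁, α₂ > 0` with
`α₁ + α₂ = 1`, and let `Q(2n+1) = [[4^{nα₁}, 4^{(n+1)α₁}]] × [[4^{nα₂}, 4^{(n+2)α₂}]]`
and `Q(2n+2) = [[4^{nα₁}, 4^{(n+2)α₁}]] × [[4^{(n+1)α₂}, 4^{(n+2)α₂}]]` be rectangles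
in `ℤ²`, where `[[x,y]]` is the set of integers between `x` and `y`.  Then the sequence
`(Q(m))_{m ≥ 1}` has multiplicity `4`: no point of `ℤ²` lies in more than `4` of the
sets `Q(m)`. -/
theorem rectangles_multiplicity_four (α₁ α₂ : ℝ) (h1 : 0 < α₁) (h2 : 0 < α₂)
    (hsum : α₁ + α₂ = 1)
    (Q : ℕ → Set (ℤ × ℤ))
    (hodd : ∀ n : ℕ, Q (2 * n + 1) = {p : ℤ × ℤ |
      ((4 : ℝ) ^ ((n : ℝ) * α₁) ≤ (p.1 : ℝ) ∧ (p.1 : ℝ) ≤ (4 : ℝ) ^ (((n : ℝ) + 1) * α₁)) ∧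
      ((4 : ℝ) ^ ((n : ℝ) * α₂) ≤ (p.2 : ℝ) ∧ (p.2 : ℝ) ≤ (4 : ℝ) ^ (((n : ℝ) + 2) * α₂))})
    (heven : ∀ n : ℕ, Q (2 * n + 2) = {p : ℤ × ℤ |
      ((4 : ℝ) ^ ((n : ℝ) * α₁) ≤ (p.1 : ℝ) ∧ (p.1 : ℝ) ≤ (4 : ℝ) ^ (((n : ℝ) + 2) * α₁)) ∧
      ((4 : ℝ) ^ (((n : ℝ) + 1) * α₂) ≤ (p.2 : ℝ) ∧ (p.2 : ℝ) ≤ (4 : ℝ) ^ (((n : ℝ) + 2) * α₂))}) :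
    ∀ p : ℤ × ℤ, ∀ s : Finset ℕ, (∀ m ∈ s, 1 ≤ m ∧ p ∈ Q m) → s.card ≤ 4 := by
  intro p s hs
  have hA : (s.filter (fun m => m % 2 = 1)).card ≤ 2 := by
    apply card_le_two_of_close
    intro x hx y hy
    rw [Finset.mem_filter] at hx hy
    obtain ⟨hx, hx2⟩ := hx
    obtain ⟨hy, hy2⟩ := hy
    obtain ⟨a, rfl⟩ : ∃ a, x = 2 * a + 1 := ⟨x / 2, by omega⟩
    obtain ⟨b, rfl⟩ : ∃ b, y = 2 * b + 1 := ⟨y / 2, by omega⟩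
    have ha := (hs _ hx).2
    have hb := (hs _ hy).2
    rw [hodd] at ha hb
    have h : (a : ℝ) ≤ (b : ℝ) + 1 := le_of_rpow_le h1 ha.1.1 hb.1.2
    have h' : a ≤ b + 1 := by exact_mod_cast h
    omega
  have hB : (s.filter (fun m => ¬ m % 2 = 1)).card ≤ 2 := by
    apply card_le_two_of_close
    intro x hx y hy
    rw [Finset.mem_filter] at hx hy
    obtain ⟨hx, hx2⟩ := hx
    obtain ⟨hy, hy2⟩ := hy
    have hx1 := (hs _ hx).1
    have hy1 := (hs _ hy).1
    obtain ⟨a, rfl⟩ : ∃ a, x = 2 * a + 2 := ⟨x / 2 - 1, by omega⟩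
    obtain ⟨b, rfl⟩ : ∃ b, y = 2 * b + 2 := ⟨y / 2 - 1, by omega⟩
    have ha := (hs _ hx).2
    have hb := (hs _ hy).2
    rw [heven] at ha hb
    have h : (a : ℝ) + 1 ≤ (b : ℝ) + 2 := le_of_rpow_le h2 ha.2.1 hb.2.2
    have h' : a + 1 ≤ b + 2 := by exact_mod_cast h
    omega
  have := Finset.card_filter_add_card_filter_not (s := s) (fun m => m % 2 = 1)
  omega
end
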